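/- arXiv:1506.00126 — 2 statements merged into one kernel-verified Lean document; each statement's English description precedes it below -/
import Mathlib

section
/- Almost-everywhere Euler–Lagrange identity on the bounded domain: Let (ρ_h^k)_k be the semi-implicit JKO sequence on the smooth bounded domain Ω. Then for every k ≥ 0, the pressure satisfies P(ρ_h^{k+1}) ∈ W^{1,1}(Ω) and (y − T_k(y)) ρ_h^{k+1}(y) + h ∇(V[ρ_h^k])(y) ρ_h^{k+1}(y) + h ∇(P(ρ_h^{k+1}))(y) = 0 for a.e. y ∈ Ω, where T_k is the optimal transport map from ρ_h^{k+1} to ρ_h^k. -/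
open MeasureTheory Filter Topology Set
open scoped ENNReal NNReal RealInnerProductSpace Classical

noncomputable section

abbrev Rn (n : ℕ) := EuclideanSpace ℝ (Fin n)

namespace Paper

variable {n l : ℕ}

/-- Second moment (extended-real valued). -/
def M2 (μ : Measure (Rn n)) : ℝ≥0∞ := ∫⁻ x, (‖x‖₊ : ℝ≥0∞) ^ 2 ∂μ

/-- Absolutely continuous probability measures with finite second moment. -/
def P2ac (n : ℕ) : Set (Measure (Rn n)) :=
  {μ | IsProbabilityMeasure μ ∧ μ ≪ (volume : Measure (Rn n)) ∧ M2 μ < ⊤}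

/-- Probability measures with finite second moment. -/
def P2 (n : ℕ) : Set (Measure (Rn n)) :=
  {μ | IsProbabilityMeasure μ ∧ M2 μ < ⊤}

/-- Couplings between two measures. -/
def couplings (ρ μ : Measure (Rn n)) : Set (Measure (Rn n × Rn n)) :=
  {γ | IsProbabilityMeasure γ ∧ γ.map Prod.fst = ρ ∧ γ.map Prod.snd = μ}

/-- Quadratic transport cost of a plan. -/
def transportCost (γ : Measure (Rn n × Rn n)) : ℝ≥0∞ :=
  ∫⁻ p, (‖p.1 - p.2‖₊ : ℝ≥0∞) ^ 2 ∂γ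

/-- Squared 2-Wasserstein distance (extended-real valued). -/
def W2e (ρ μ : Measure (Rn n)) : ℝ≥0∞ := ⨅ γ ∈ couplings ρ μ, transportCost γ

/-- 2-Wasserstein distance. -/
def W2 (ρ μ : Measure (Rn n)) : ℝ := Real.sqrt (W2e ρ μ).toReal

/-- 1-Wasserstein distance. -/
def W1 (ρ μ : Measure (Rn n)) : ℝ :=
  (⨅ γ ∈ couplings ρ μ, ∫⁻ p : Rn n × Rn n, (‖p.1 - p.2‖₊ : ℝ≥0∞) ∂γ).toReal

/-- A coupling is an optimal transport plan for the quadratic cost. -/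
def IsOptimalPlan (ρ μ : Measure (Rn n)) (γ : Measure (Rn n × Rn n)) : Prop :=
  γ ∈ couplings ρ μ ∧ transportCost γ = W2e ρ μ

/-- `T` is an optimal transport map from `ρ` to `μ` for the quadratic cost. -/
def IsOptimalMap (ρ μ : Measure (Rn n)) (T : Rn n → Rn n) : Prop :=
  Measurable T ∧ IsOptimalPlan ρ μ (ρ.map fun x => (x, T x))

/-- Lebesgue density of a measure. -/
def dens (μ : Measure (Rn n)) : Rn n → ℝ := fun x => (μ.rnDeriv volume x).toReal

/-- The pressure associated to an internal energy density `F`. -/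
def pressure (F : ℝ → ℝ) (x : ℝ) : ℝ := x * deriv F x - F x

/-- The class `H_m` of internal energy densities. -/
def HmClass (m : ℝ) (F : ℝ → ℝ) : Prop :=
  (m = 1 ∧ ∀ x, F x = x * Real.log x) ∨
  (1 < m ∧ StrictConvexOn ℝ (Set.Ici 0) F ∧
    Tendsto (fun x => F x / x) atTop atTop ∧
    F 0 = 0 ∧ deriv F 0 = 0 ∧
    (∃ C > 0, ∀ x : ℝ, 0 < x → C * x ^ (m - 2) ≤ deriv (deriv F) x) ∧
    (∃ C > 0, ∀ x : ℝ, 0 ≤ x → pressure F x ≤ C * (x + x ^ m)))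

/-- The internal energy functional `F(ρ) = ∫ F(ρ)` (`+∞` if `ρ` is not absolutely
continuous or the energy is not finite). -/
def FfuncE (F : ℝ → ℝ) (μ : Measure (Rn n)) : EReal :=
  if μ ≪ (volume : Measure (Rn n)) ∧ Integrable (fun x => F (dens μ x)) volume
  then ((∫ x, F (dens μ x) : ℝ) : EReal) else ⊤

/-- The potential energy functional `V(ρ|μ) = ∫ V[μ] ρ`. -/
def VfuncE (Vf : Rn n → ℝ) (μ : Measure (Rn n)) : EReal :=
  if Integrable Vf μ then ((∫ x, Vf x ∂μ : ℝ) : EReal) else ⊤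

/-- Tuples of probability measures. -/
def ProbTuple (l n : ℕ) : Set (Fin l → Measure (Rn n)) :=
  {ρ | ∀ j, IsProbabilityMeasure (ρ j)}

/-- `V[ρ]` is a `C²` function for every tuple of probability measures. -/
def VSmooth (V : (Fin l → Measure (Rn n)) → Rn n → ℝ) : Prop :=
  ∀ ρ ∈ ProbTuple l n, ContDiff ℝ 2 (V ρ)

/-- Hypothesis (H1): nonnegativity. -/
def VH1 (V : (Fin l → Measure (Rn n)) → Rn n → ℝ) : Prop :=
  ∀ ρ ∈ ProbTuple l n, ∀ x, 0 ≤ V ρ x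

/-- Hypothesis (H2): uniform bound on first and second derivatives. -/
def VH2 (C : ℝ) (V : (Fin l → Measure (Rn n)) → Rn n → ℝ) : Prop :=
  ∀ ρ ∈ ProbTuple l n, ∀ x,
    ‖gradient (V ρ) x‖ + ‖fderiv ℝ (fun y => gradient (V ρ) y) x‖ ≤ C

/-- Hypothesis (H3): Lipschitz dependence of `∇V[ρ]` on `ρ` w.r.t. `W₂`. -/
def VH3 (C : ℝ) (V : (Fin l → Measure (Rn n)) → Rn n → ℝ) : Prop :=
  ∀ ν ∈ ProbTuple l n, ∀ σ ∈ ProbTuple l n, ∀ x,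
    ‖gradient (V ν) x - gradient (V σ) x‖ ≤ C * ∑ j, W2 (ν j) (σ j)

/-- All the structural hypotheses on the interaction potentials. -/
def VHyp (V : Fin l → (Fin l → Measure (Rn n)) → Rn n → ℝ) : Prop :=
  (∀ i, VSmooth (V i)) ∧ (∀ i, VH1 (V i)) ∧
  (∃ C > 0, ∀ i, VH2 C (V i)) ∧ (∃ C > 0, ∀ i, VH3 C (V i))

/-- The semi-implicit JKO functional. -/
def JKOEnergy (h : ℝ) (F : ℝ → ℝ) (Vf : Rn n → ℝ) (μprev ρ : Measure (Rn n)) : EReal :=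
  ((W2 ρ μprev ^ 2 : ℝ) : EReal) + ((2 * h : ℝ) : EReal) * (FfuncE F ρ + VfuncE Vf ρ)

/-- The semi-implicit JKO scheme. -/
def JKOSeq (h : ℝ) (F : Fin l → ℝ → ℝ) (V : Fin l → (Fin l → Measure (Rn n)) → Rn n → ℝ)
    (ρ₀ : Fin l → Measure (Rn n)) (ρh : Fin l → ℕ → Measure (Rn n)) : Prop :=
  (∀ i, ρh i 0 = ρ₀ i) ∧
  ∀ i k, ρh i (k + 1) ∈ P2ac n ∧
    ∀ ρ ∈ P2ac n,
      JKOEnergy h (F i) (V i fun j => ρh j k) (ρh i k) (ρh i (k + 1)) ≤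
      JKOEnergy h (F i) (V i fun j => ρh j k) (ρh i k) ρ

/-- Piecewise-constant interpolation of the discrete scheme:
`ρ_h(t) = ρ_h^k` for `t ∈ ((k-1)h, kh]`. -/
def interp (h : ℝ) (ρh : ℕ → Measure (Rn n)) (t : ℝ) : Measure (Rn n) := ρh ⌈t / h⌉₊

/-- The Laplacian of a function on `ℝⁿ`. -/
def lap (f : Rn n → ℝ) (x : Rn n) : ℝ :=
  ∑ j : Fin n, iteratedFDeriv ℝ 2 f x
    ![EuclideanSpace.single j 1, EuclideanSpace.single j 1]

/-- Weak (distributional) gradient on `ℝⁿ`. -/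
def HasWeakGradient (f : Rn n → ℝ) (g : Rn n → Rn n) : Prop :=
  LocallyIntegrable f volume ∧ LocallyIntegrable g volume ∧
  ∀ φ : Rn n → ℝ, ContDiff ℝ (⊤ : ℕ∞) φ → HasCompactSupport φ → ∀ j : Fin n,
    ∫ x, f x * fderiv ℝ φ x (EuclideanSpace.single j 1) =
      - ∫ x, ⟪g x, EuclideanSpace.single j 1⟫ * φ x

/-- Spatial gradient of a space-time test function. -/
def spatialGrad (φ : ℝ × Rn n → ℝ) (t : ℝ) (x : Rn n) : Rn n :=
  gradient (fun y => φ (t, y)) x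

/-- Time derivative of a space-time test function. -/
def timeDeriv (φ : ℝ × Rn n → ℝ) (t : ℝ) (x : Rn n) : ℝ :=
  deriv (fun s => φ (s, x)) t

/-- Weak solution of the system on `ℝⁿ`. -/
def IsWeakSolution (F : Fin l → ℝ → ℝ) (α : Fin l → ℝ)
    (V : Fin l → (Fin l → Measure (Rn n)) → Rn n → ℝ)
    (ρ₀ : Fin l → Measure (Rn n)) (ρ : Fin l → ℝ → Measure (Rn n)) : Prop :=
  (∀ i t, 0 ≤ t → ρ i t ∈ P2ac n) ∧
  (∀ i, ρ i 0 = ρ₀ i) ∧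
  (∀ i t₀, 0 ≤ t₀ →
    Tendsto (fun t => W2 (ρ i t) (ρ i t₀)) (nhdsWithin t₀ (Ici 0)) (nhds 0)) ∧
  (∀ i T, 0 < T →
    ∫⁻ t in Ioo (0 : ℝ) T, ∫⁻ x, ENNReal.ofReal |pressure (F i) (dens (ρ i t) x)| < ⊤) ∧
  (∀ i, ∀ φ : ℝ × Rn n → ℝ, ContDiff ℝ (⊤ : ℕ∞) φ → HasCompactSupport φ →
    ∫ t in Ioi (0 : ℝ), ∫ x,
        ((timeDeriv φ t x -
            ⟪spatialGrad φ t x, gradient (V i fun j => ρ j t) x⟫) * dens (ρ i t) x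
          + α i * lap (fun y => φ (t, y)) x * pressure (F i) (dens (ρ i t) x)) =
      - ∫ x, φ (0, x) * dens (ρ₀ i) x)

/-! ### κ-flows and dissipation -/

/-- The curve `s ↦ S s ρ` is absolutely continuous on `ℝ⁺` w.r.t. `W₂`. -/
def ACCurve (S : ℝ → Measure (Rn n) → Measure (Rn n)) (ρ : Measure (Rn n)) : Prop :=
  ∃ g : ℝ → ℝ, (∀ a b : ℝ, 0 ≤ a → a ≤ b → IntervalIntegrable g volume a b) ∧
    ∀ a b : ℝ, 0 ≤ a → a ≤ b → W2 (S a ρ) (S b ρ) ≤ ∫ τ in a..b, g τ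

/-- Upper right Dini derivative (extended-real valued). -/
def dplus (f : ℝ → ℝ) (t : ℝ) : EReal :=
  limsup (fun s : ℝ => (((f s - f t) / (s - t) : ℝ) : EReal)) (nhdsWithin t (Ioi t))

/-- `S` is a `κ`-flow for the functional `Ψ` w.r.t. `W₂`. -/
def IsKappaFlow (κ : ℝ) (Ψ : Measure (Rn n) → EReal)
    (S : ℝ → Measure (Rn n) → Measure (Rn n)) : Prop :=
  (∀ ρ ∈ P2ac n, ∀ s : ℝ, 0 ≤ s → S s ρ ∈ P2ac n) ∧
  (∀ ρ ∈ P2ac n, S 0 ρ = ρ) ∧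
  (∀ ρ ∈ P2ac n, ∀ s t : ℝ, 0 ≤ s → 0 ≤ t → S (s + t) ρ = S s (S t ρ)) ∧
  (∀ ρ ∈ P2ac n, ACCurve S ρ) ∧
  (∀ ρ ∈ P2ac n, ∀ ρ' ∈ P2ac n, Ψ ρ' < ⊤ → ∀ s : ℝ, 0 < s →
    (((1 : ℝ) / 2 : ℝ) : EReal) * dplus (fun σ => W2 (S σ ρ) ρ' ^ 2) s
        + ((κ / 2 * W2 (S s ρ) ρ' ^ 2 : ℝ) : EReal) ≤ Ψ ρ' - Ψ (S s ρ))

/-- Dissipation of `F_i + V_i(·|μ)` along the flow `S`. -/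
def Diss (F : ℝ → ℝ) (Vf : Rn n → ℝ) (S : ℝ → Measure (Rn n) → Measure (Rn n))
    (ρ : Measure (Rn n)) : EReal :=
  limsup (fun s : ℝ => (((1 : ℝ) / s : ℝ) : EReal) *
      (FfuncE F ρ - FfuncE F (S s ρ) + (VfuncE Vf ρ - VfuncE Vf (S s ρ))))
    (nhdsWithin 0 (Ioi 0))

/-- Sequential lower semicontinuity w.r.t. `W₂` on `P₂^{ac}`. -/
def W2LSC (Ψ : Measure (Rn n) → EReal) : Prop :=
  ∀ ρ ∈ P2ac n, ∀ ρs : ℕ → Measure (Rn n), (∀ k, ρs k ∈ P2ac n) →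
    Tendsto (fun k => W2 (ρs k) ρ) atTop (nhds 0) →
    Ψ ρ ≤ liminf (fun k => Ψ (ρs k)) atTop

/-! ### Bounded domains -/

/-- Probability measures supported in `Ω`. -/
def POn (Ω : Set (Rn n)) : Set (Measure (Rn n)) :=
  {μ | IsProbabilityMeasure μ ∧ μ Ωᶜ = 0}

/-- Absolutely continuous probability measures supported in `Ω`. -/
def PacOn (Ω : Set (Rn n)) : Set (Measure (Rn n)) :=
  {μ | IsProbabilityMeasure μ ∧ μ ≪ (volume : Measure (Rn n)) ∧ μ Ωᶜ = 0}

/-- Internal energy on a domain `Ω`. -/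
def FfuncEOn (Ω : Set (Rn n)) (F : ℝ → ℝ) (μ : Measure (Rn n)) : EReal :=
  if μ ≪ (volume : Measure (Rn n)) ∧ IntegrableOn (fun x => F (dens μ x)) Ω volume
  then ((∫ x in Ω, F (dens μ x) : ℝ) : EReal) else ⊤

/-- The semi-implicit JKO functional on a domain `Ω`. -/
def JKOEnergyOn (Ω : Set (Rn n)) (h : ℝ) (F : ℝ → ℝ) (Vf : Rn n → ℝ)
    (μprev ρ : Measure (Rn n)) : EReal :=
  ((1 / (2 * h) * W2 ρ μprev ^ 2 : ℝ) : EReal) + FfuncEOn Ω F ρ + VfuncE Vf ρ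

/-- The semi-implicit JKO scheme on a domain `Ω` (single species). -/
def JKOSeqOn (Ω : Set (Rn n)) (h : ℝ) (F : ℝ → ℝ) (V : Measure (Rn n) → Rn n → ℝ)
    (ρ₀ : Measure (Rn n)) (ρh : ℕ → Measure (Rn n)) : Prop :=
  ρh 0 = ρ₀ ∧
  ∀ k, ρh (k + 1) ∈ POn Ω ∧
    ∀ ρ ∈ POn Ω,
      JKOEnergyOn Ω h F (V (ρh k)) (ρh k) (ρh (k + 1)) ≤
      JKOEnergyOn Ω h F (V (ρh k)) (ρh k) ρ

/-- Hypotheses (H1), (H2), (H3) for a single interaction potential on `Ω`. -/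
def VHypOn (Ω : Set (Rn n)) (V : Measure (Rn n) → Rn n → ℝ) : Prop :=
  (∀ μ ∈ POn Ω, ContDiff ℝ 2 (V μ)) ∧
  (∀ μ ∈ POn Ω, ∀ x, 0 ≤ V μ x) ∧
  (∃ C > 0, ∀ μ ∈ POn Ω, ∀ x,
    ‖gradient (V μ) x‖ + ‖fderiv ℝ (fun y => gradient (V μ) y) x‖ ≤ C) ∧
  (∃ C > 0, ∀ μ ∈ POn Ω, ∀ ν ∈ POn Ω, ∀ x,
    ‖gradient (V μ) x - gradient (V ν) x‖ ≤ C * W2 μ ν)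

/-- Weak (distributional) gradient on an open set `Ω`, together with `W^{1,1}`
integrability of the function and its gradient. -/
def HasWeakGradientOn (Ω : Set (Rn n)) (f : Rn n → ℝ) (g : Rn n → Rn n) : Prop :=
  IntegrableOn f Ω volume ∧ IntegrableOn g Ω volume ∧
  ∀ φ : Rn n → ℝ, ContDiff ℝ (⊤ : ℕ∞) φ → HasCompactSupport φ → tsupport φ ⊆ Ω →
    ∀ j : Fin n,
      ∫ x in Ω, f x * fderiv ℝ φ x (EuclideanSpace.single j 1) =
        - ∫ x in Ω, ⟪g x, EuclideanSpace.single j 1⟫ * φ x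

section InternalEnergy

theorem tangent_le_of_convexOn {s : Set ℝ} {f : ℝ → ℝ} (hf : ConvexOn ℝ s f) {a x f' : ℝ}
    (ha : a ∈ s) (hx : x ∈ s) (hd : HasDerivAt f f' a) : f a + f' * (x - a) ≤ f x := by
  rcases lt_trichotomy x a with h | rfl | h
  · have := hf.slope_le_of_hasDerivAt hx ha h hd
    rw [slope_def_field, div_le_iff₀ (by linarith)] at this
    linarith
  · simp
  · have := hf.le_slope_of_hasDerivAt ha hx h hd
    rw [slope_def_field, le_div_iff₀ (by linarith)] at this
    linarith

variable {m : ℝ} {F : ℝ → ℝ}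

theorem HmClass.map_zero (hF : HmClass m F) : F 0 = 0 := by
  rcases hF with ⟨-, h⟩ | ⟨-, -, -, h, -⟩
  · simp [h]
  · exact h

theorem HmClass.convexOn (hF : HmClass m F) : ConvexOn ℝ (Ici 0) F := by
  rcases hF with ⟨-, h⟩ | ⟨-, h, -⟩
  · rw [funext h]
    exact Real.convexOn_mul_log
  · exact h.convexOn

theorem HmClass.continuousOn (hF : HmClass m F) : ContinuousOn F (Ioi 0) := by
  simpa using hF.convexOn.continuousOn_interior

/-- The lower bound on `F''` rules out kinks, although it is stated with junk-valued derivatives. -/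
theorem HmClass.differentiableAt (hF : HmClass m F) {x : ℝ} (hx : 0 < x) :
    DifferentiableAt ℝ F x := by
  have hc : ContinuousAt F x := hF.continuousOn.continuousAt (Ioi_mem_nhds hx)
  rcases hF with ⟨-, h⟩ | ⟨-, -, -, -, -, ⟨C, hC, h2⟩, -⟩
  · rw [funext h]
    exact (Real.hasDerivAt_mul_log hx.ne').differentiableAt
  · have hpos : 0 < deriv (deriv F) x :=
      (mul_pos hC (Real.rpow_pos_of_pos hx _)).trans_le (h2 x hx)
    have hd : DifferentiableAt ℝ (deriv F) x := differentiableAt_of_deriv_ne_zero hpos.ne'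
    have hne : ∀ᶠ y in 𝓝[≠] x, DifferentiableAt ℝ F y :=
      (hd.hasDerivAt.eventually_ne (c := 0) hpos.ne').mono
        fun y hy => differentiableAt_of_deriv_ne_zero hy
    have hr : HasDerivWithinAt F (deriv F x) (Ici x) x :=
      hasDerivWithinAt_Ici_of_tendsto_deriv (s := {y | DifferentiableAt ℝ F y})
        (fun y hy => DifferentiableAt.differentiableWithinAt hy) hc.continuousWithinAt
        (hne.filter_mono (nhdsWithin_mono _ fun y hy => ne_of_gt hy))
        (hd.continuousAt.tendsto.mono_left nhdsWithin_le_nhds)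
    have hl : HasDerivWithinAt F (deriv F x) (Iic x) x :=
      hasDerivWithinAt_Iic_of_tendsto_deriv (s := {y | DifferentiableAt ℝ F y})
        (fun y hy => DifferentiableAt.differentiableWithinAt hy) hc.continuousWithinAt
        (hne.filter_mono (nhdsWithin_mono _ fun y hy => ne_of_lt hy))
        (hd.continuousAt.tendsto.mono_left nhdsWithin_le_nhds)
    have := hl.union hr
    rw [Iic_union_Ici] at this
    exact (hasDerivWithinAt_univ.1 this).differentiableAt

theorem HmClass.pressure_zero (hF : HmClass m F) : pressure F 0 = 0 := by
  simp [pressure, hF.map_zero]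

theorem HmClass.pressure_nonneg (hF : HmClass m F) {x : ℝ} (hx : 0 ≤ x) : 0 ≤ pressure F x := by
  rcases hx.eq_or_lt with rfl | hx
  · exact hF.pressure_zero.ge
  · have := tangent_le_of_convexOn hF.convexOn hx.le (mem_Ici.2 le_rfl)
      (hF.differentiableAt hx).hasDerivAt
    rw [hF.map_zero] at this
    simp only [pressure]
    linarith

theorem HmClass.one_le (hF : HmClass m F) : 1 ≤ m := by
  rcases hF with ⟨rfl, -⟩ | ⟨h, -⟩
  · exact le_rfl
  · exact h.le

theorem HmClass.exists_pressure_le (hF : HmClass m F) :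
    ∃ C > 0, ∀ x : ℝ, 0 ≤ x → pressure F x ≤ C * (x + x ^ m) := by
  rcases hF with ⟨rfl, h⟩ | ⟨-, -, -, -, -, -, h⟩
  · refine ⟨1, one_pos, fun x hx => ?_⟩
    rcases hx.eq_or_lt with rfl | hx
    · simp [pressure, h]
    · have hd : deriv F x = Real.log x + 1 := by
        rw [funext h]
        exact Real.deriv_mul_log hx.ne'
      rw [pressure, hd, h, Real.rpow_one]
      linarith
  · exact h

theorem HmClass.exists_rpow_le (hF : HmClass m F) :
    ∃ A > 0, ∀ x : ℝ, 0 ≤ x → x ^ m ≤ A * (|F x| + x + 1) := by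
  have hFd := @HmClass.differentiableAt m F hF
  rcases hF with ⟨rfl, h⟩ | ⟨hm, -, -, -, -, ⟨C, hC, h2⟩, -⟩
  · exact ⟨1, one_pos, fun x hx => by rw [Real.rpow_one]; linarith [abs_nonneg (F x)]⟩
  have hc : 0 < C / (m * (m - 1)) := div_pos hC (mul_pos (by linarith) (by linarith))
  set c := C / (m * (m - 1)) with hc_def
  set G : ℝ → ℝ := fun x => F x - c * x ^ m with hG
  have hG1 : ∀ x, 0 < x → HasDerivAt G (deriv F x - c * (m * x ^ (m - 1))) x := fun x hx =>
    (hFd hx).hasDerivAt.sub ((Real.hasDerivAt_rpow_const (Or.inl hx.ne')).const_mul c)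
  have hF2 : ∀ x, 0 < x → DifferentiableAt ℝ (deriv F) x := fun x hx =>
    differentiableAt_of_deriv_ne_zero
      ((mul_pos hC (Real.rpow_pos_of_pos hx _)).trans_le (h2 x hx)).ne'
  have hG2 : ∀ x, 0 < x → HasDerivAt (deriv G) (deriv (deriv F) x - C * x ^ (m - 2)) x := by
    intro x hx
    have h3 : HasDerivAt (fun x => deriv F x - c * (m * x ^ (m - 1)))
        (deriv (deriv F) x - c * (m * ((m - 1) * x ^ (m - 1 - 1)))) x :=
      (hF2 x hx).hasDerivAt.sub
        (((Real.hasDerivAt_rpow_const (Or.inl hx.ne')).const_mul m).const_mul c)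
    have h4 : c * (m * ((m - 1) * x ^ (m - 1 - 1))) = C * x ^ (m - 2) := by
      rw [show m - 1 - 1 = m - 2 by ring, hc_def]
      have : m - 1 ≠ 0 := by linarith
      have : m ≠ 0 := by linarith
      field_simp
    rw [h4] at h3
    refine h3.congr_of_eventuallyEq ?_
    filter_upwards [Ioi_mem_nhds hx] with y hy using (hG1 y hy).deriv
  have hconv : ConvexOn ℝ (Ioi 0) G := by
    refine convexOn_of_deriv2_nonneg' (convex_Ioi 0)
      (fun x hx => (hG1 x hx).differentiableAt.differentiableWithinAt)
      (fun x hx => (hG2 x hx).differentiableAt.differentiableWithinAt) fun x hx => ?_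
    simp only [Function.iterate_succ, Function.iterate_zero, Function.comp_apply, id]
    rw [(hG2 x hx).deriv]
    linarith [h2 x hx]
  set b := deriv F 1 - c * (m * 1 ^ (m - 1)) with hb
  refine ⟨(1 + |G 1| + |b|) / c, by positivity, fun x hx => ?_⟩
  rcases hx.eq_or_lt with rfl | hx
  · rw [Real.zero_rpow (by linarith)]
    positivity
  have ht := tangent_le_of_convexOn hconv (mem_Ioi.2 one_pos) hx (hG1 1 one_pos)
  rw [← hb, show G x = F x - c * x ^ m from rfl] at ht
  rw [div_mul_eq_mul_div, le_div_iff₀ hc]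
  have e1 := neg_abs_le (G 1)
  have e2 : -(|b| * (x + 1)) ≤ b * (x - 1) := by
    have := neg_abs_le (b * (x - 1))
    rw [abs_mul] at this
    have h5 : |x - 1| ≤ x + 1 := by rw [abs_le]; constructor <;> linarith
    nlinarith [mul_le_mul_of_nonneg_left h5 (abs_nonneg b)]
  nlinarith [le_abs_self (F x), abs_nonneg (G 1), abs_nonneg b, abs_nonneg (F x),
    mul_nonneg (abs_nonneg (G 1)) (abs_nonneg (F x)), mul_nonneg (abs_nonneg b) (abs_nonneg (F x)),
    mul_nonneg (abs_nonneg (G 1)) hx.le]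

theorem HmClass.measurable_comp (hF : HmClass m F) {α : Type*} [MeasurableSpace α] {r : α → ℝ}
    (hr : Measurable r) (hr0 : ∀ x, 0 ≤ r x) : Measurable fun x => F (r x) := by
  have hm : Measurable ((Ioi (0 : ℝ)).piecewise F fun _ => 0) :=
    hF.continuousOn.measurable_piecewise continuousOn_const measurableSet_Ioi
  convert hm.comp hr using 2 with x
  rcases (hr0 x).eq_or_lt with h | h
  · simp [← h, hF.map_zero]
  · simp [h]

theorem HmClass.measurable_pressure_comp (hF : HmClass m F) {α : Type*} [MeasurableSpace α]
    {r : α → ℝ} (hr : Measurable r) (hr0 : ∀ x, 0 ≤ r x) :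
    Measurable fun x => pressure F (r x) :=
  (hr.mul ((measurable_deriv F).comp hr)).sub (hF.measurable_comp hr hr0)

/-- The derivative of `J ↦ J F(r / J)`. -/
theorem HmClass.hasDerivAt_perspective (hF : HmClass m F) {r J : ℝ} (hr : 0 ≤ r) (hJ : 0 < J) :
    HasDerivAt (fun J => J * F (r / J)) (-pressure F (r / J)) J := by
  rcases hr.eq_or_lt with rfl | hr
  · simpa [hF.map_zero, hF.pressure_zero] using hasDerivAt_const J (0 : ℝ)
  have h1 : HasDerivAt (fun J => r / J) (-r / J ^ 2) J := by
    simpa using (hasDerivAt_const J r).fun_div (hasDerivAt_id' J) hJ.ne'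
  have h2 := (hasDerivAt_id' J).fun_mul
    ((hF.differentiableAt (div_pos hr hJ)).hasDerivAt.comp J h1)
  refine h2.congr_deriv ?_
  simp only [pressure, Function.comp]
  field_simp
  ring

end InternalEnergy

section ChangeOfVariables

variable {Ω : Set (Rn n)} {ρ : Measure (Rn n)} {T : Rn n → Rn n} {T' : Rn n → Rn n →L[ℝ] Rn n}
  {J : Rn n → ℝ}

theorem dens_nonneg (ρ : Measure (Rn n)) (x : Rn n) : 0 ≤ dens ρ x := ENNReal.toReal_nonneg

theorem measurable_dens (ρ : Measure (Rn n)) : Measurable (dens ρ) :=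
  (Measure.measurable_rnDeriv ρ volume).ennreal_toReal

theorem ofReal_dens_ae (ρ : Measure (Rn n)) [IsProbabilityMeasure ρ] :
    ∀ᵐ x, ENNReal.ofReal (dens ρ x) = ρ.rnDeriv volume x := by
  filter_upwards [Measure.rnDeriv_lt_top ρ volume] with x hx using ENNReal.ofReal_toReal hx.ne

/-- The density of `T_# ρ` when `T` has Jacobian determinant `J` and `ρ` is carried by `Ω`. -/
def mapDens (Ω : Set (Rn n)) (ρ : Measure (Rn n)) (T : Rn n → Rn n) (J : Rn n → ℝ) : Rn n → ℝ :=
  Function.extend T (Ω.indicator fun x => dens ρ x / J x) 0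

theorem mapDens_apply (hinj : Function.Injective T) {x : Rn n} (hx : x ∈ Ω) :
    mapDens Ω ρ T J (T x) = dens ρ x / J x := by
  rw [mapDens, hinj.extend_apply, indicator_of_mem hx]

theorem mapDens_eq_zero (hinj : Function.Injective T) {y : Rn n} (hy : y ∉ T '' Ω) :
    mapDens Ω ρ T J y = 0 := by
  by_cases h : ∃ x, T x = y
  · obtain ⟨x, rfl⟩ := h
    rw [mapDens, hinj.extend_apply, indicator_of_notMem]
    exact fun hx => hy (mem_image_of_mem T hx)
  · rw [mapDens, Function.extend_apply' _ _ _ h, Pi.zero_apply]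

theorem measurable_mapDens (hΩ : MeasurableSet Ω) (hT : Continuous T)
    (hinj : Function.Injective T) (hJ : Measurable J) : Measurable (mapDens Ω ρ T J) :=
  (hT.measurableEmbedding hinj).measurable_extend
    (((measurable_dens ρ).div hJ).indicator hΩ) measurable_const

theorem map_eq_withDensity_mapDens [IsProbabilityMeasure ρ] (hac : ρ ≪ volume)
    (hρΩ : ρ Ωᶜ = 0) (hΩ : MeasurableSet Ω) (hT' : ∀ x, HasFDerivAt T (T' x) x)
    (hinj : Function.Injective T) (hdet : ∀ x, (T' x).det = J x) (hJpos : ∀ x, 0 < J x) :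
    ρ.map T = volume.withDensity fun y => ENNReal.ofReal (mapDens Ω ρ T J y) := by
  have hT : Continuous T := continuous_iff_continuousAt.2 fun x => (hT' x).continuousAt
  ext A hA
  have hs : MeasurableSet (Ω ∩ T ⁻¹' A) := hΩ.inter (hT.measurable hA)
  rw [Measure.map_apply hT.measurable hA, withDensity_apply _ hA, ← lintegral_indicator hA]
  have hind : (A.indicator fun y => ENNReal.ofReal (mapDens Ω ρ T J y)) =
      (T '' (Ω ∩ T ⁻¹' A)).indicator fun y => ENNReal.ofReal (mapDens Ω ρ T J y) := by
    ext y
    by_cases hy : y ∈ T '' (Ω ∩ T ⁻¹' A)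
    · have hyA : y ∈ A := by
        obtain ⟨x, hx, rfl⟩ := hy
        exact hx.2
      rw [indicator_of_mem hy, indicator_of_mem hyA]
    · rw [indicator_of_notMem hy]
      by_cases hyA : y ∈ A
      · rw [indicator_of_mem hyA, mapDens_eq_zero hinj, ENNReal.ofReal_zero]
        rintro ⟨x, hx, rfl⟩
        exact hy ⟨x, ⟨hx, hyA⟩, rfl⟩
      · rw [indicator_of_notMem hyA]
  rw [hind, lintegral_indicator ((hT.measurableEmbedding hinj).measurableSet_image.2 hs),
    lintegral_image_eq_lintegral_abs_det_fderiv_mul volume hs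
      (fun x _ => (hT' x).hasFDerivWithinAt) hinj.injOn]
  have hcongr : ∫⁻ x in Ω ∩ T ⁻¹' A, ENNReal.ofReal |(T' x).det| *
      ENNReal.ofReal (mapDens Ω ρ T J (T x)) = ∫⁻ x in Ω ∩ T ⁻¹' A, ρ.rnDeriv volume x := by
    refine setLIntegral_congr_fun_ae hs ?_
    filter_upwards [ofReal_dens_ae ρ] with x hx hxs
    rw [mapDens_apply hinj hxs.1, hdet, abs_of_pos (hJpos x), ← ENNReal.ofReal_mul (hJpos x).le,
      mul_div_cancel₀ _ (hJpos x).ne', hx]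
  rw [hcongr, Measure.setLIntegral_rnDeriv hac]
  refine le_antisymm ?_ (measure_mono inter_subset_right)
  calc ρ (T ⁻¹' A) ≤ ρ (Ω ∩ T ⁻¹' A ∪ Ωᶜ) := measure_mono fun x hx => by
        by_cases h : x ∈ Ω
        · exact Or.inl ⟨h, hx⟩
        · exact Or.inr h
    _ ≤ ρ (Ω ∩ T ⁻¹' A) + ρ Ωᶜ := measure_union_le _ _
    _ = ρ (Ω ∩ T ⁻¹' A) := by rw [hρΩ, add_zero]

theorem mapDens_nonneg (hinj : Function.Injective T) (hJpos : ∀ x, 0 < J x) (y : Rn n) :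
    0 ≤ mapDens Ω ρ T J y := by
  by_cases hy : y ∈ T '' Ω
  · obtain ⟨x, hx, rfl⟩ := hy
    rw [mapDens_apply hinj hx]
    exact div_nonneg (dens_nonneg ρ x) (hJpos x).le
  · rw [mapDens_eq_zero hinj hy]

theorem dens_map_ae_eq [IsProbabilityMeasure ρ] (hac : ρ ≪ volume)
    (hρΩ : ρ Ωᶜ = 0) (hΩ : MeasurableSet Ω) (hT' : ∀ x, HasFDerivAt T (T' x) x)
    (hinj : Function.Injective T) (hdet : ∀ x, (T' x).det = J x) (hJpos : ∀ x, 0 < J x)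
    (hJ : Measurable J) : dens (ρ.map T) =ᵐ[volume] mapDens Ω ρ T J := by
  have hT : Continuous T := continuous_iff_continuousAt.2 fun x => (hT' x).continuousAt
  have h := Measure.rnDeriv_withDensity volume
    (measurable_mapDens (ρ := ρ) hΩ hT hinj hJ).ennreal_ofReal
  rw [← map_eq_withDensity_mapDens hac hρΩ hΩ hT' hinj hdet hJpos] at h
  filter_upwards [h] with y hy
  rw [dens, hy, ENNReal.toReal_ofReal (mapDens_nonneg hinj hJpos y)]

theorem integrableOn_comp_dens_map [IsProbabilityMeasure ρ] (hac : ρ ≪ volume)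
    (hρΩ : ρ Ωᶜ = 0) (hΩ : MeasurableSet Ω) (hT' : ∀ x, HasFDerivAt T (T' x) x)
    (hinj : Function.Injective T) (hdet : ∀ x, (T' x).det = J x) (hJpos : ∀ x, 0 < J x)
    (hJ : Measurable J) {G : ℝ → ℝ} (hG : G 0 = 0)
    (hFint : IntegrableOn (fun x => J x * G (dens ρ x / J x)) Ω) :
    IntegrableOn (fun y => G (dens (ρ.map T) y)) Ω := by
  have hT : Continuous T := continuous_iff_continuousAt.2 fun x => (hT' x).continuousAt
  have himg : MeasurableSet (T '' Ω) := (hT.measurableEmbedding hinj).measurableSet_image.2 hΩ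
  have h1 : IntegrableOn (fun y => G (mapDens Ω ρ T J y)) (T '' Ω) := by
    rw [integrableOn_image_iff_integrableOn_abs_det_fderiv_smul volume hΩ
      (fun x _ => (hT' x).hasFDerivWithinAt) hinj.injOn]
    refine hFint.congr_fun (fun x hx => ?_) hΩ
    simp only [mapDens_apply hinj hx, hdet, abs_of_pos (hJpos x), smul_eq_mul]
  have h2 : Integrable fun y => G (mapDens Ω ρ T J y) := by
    rw [← integrableOn_univ]
    refine h1.of_forall_sdiff_eq_zero MeasurableSet.univ fun y hy => ?_
    rw [mapDens_eq_zero hinj hy.2, hG]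
  refine (h2.congr ?_).integrableOn
  filter_upwards [dens_map_ae_eq hac hρΩ hΩ hT' hinj hdet hJpos hJ] with y hy
  rw [hy]

theorem setIntegral_comp_dens_map [IsProbabilityMeasure ρ] (hac : ρ ≪ volume)
    (hρΩ : ρ Ωᶜ = 0) (hΩ : MeasurableSet Ω) (hT' : ∀ x, HasFDerivAt T (T' x) x)
    (hinj : Function.Injective T) (hdet : ∀ x, (T' x).det = J x) (hJpos : ∀ x, 0 < J x)
    (hJ : Measurable J) (hmaps : MapsTo T Ω Ω) {G : ℝ → ℝ} (hG : G 0 = 0) :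
    ∫ y in Ω, G (dens (ρ.map T) y) = ∫ x in Ω, J x * G (dens ρ x / J x) := by
  have h1 : ∫ y in Ω, G (dens (ρ.map T) y) = ∫ y in Ω, G (mapDens Ω ρ T J y) := by
    refine integral_congr_ae (ae_restrict_of_ae ?_)
    filter_upwards [dens_map_ae_eq hac hρΩ hΩ hT' hinj hdet hJpos hJ] with y hy
    rw [hy]
  rw [h1, setIntegral_eq_of_subset_of_forall_sdiff_eq_zero hΩ hmaps.image_subset
      (fun y hy => by rw [mapDens_eq_zero hinj hy.2, hG]),
    integral_image_eq_integral_abs_det_fderiv_smul volume hΩ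
      (fun x _ => (hT' x).hasFDerivWithinAt) hinj.injOn]
  refine setIntegral_congr_fun hΩ fun x hx => ?_
  simp only [mapDens_apply hinj hx, hdet, abs_of_pos (hJpos x), smul_eq_mul]

end ChangeOfVariables

section Shift

variable {φ : Rn n → ℝ} {v : Rn n}

/-- The perturbation of the identity by the vector field `s φ v`. -/
def shift (φ : Rn n → ℝ) (v : Rn n) (s : ℝ) (x : Rn n) : Rn n := x + (s * φ x) • v

theorem shift_zero (x : Rn n) : shift φ v 0 x = x := by simp [shift]

theorem hasFDerivAt_shift (hφ : Differentiable ℝ φ) (s : ℝ) (x : Rn n) :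
    HasFDerivAt (shift φ v s)
      (ContinuousLinearMap.id ℝ (Rn n) + (s • fderiv ℝ φ x).smulRight v) x :=
  (hasFDerivAt_id x).add (((hφ x).hasFDerivAt.const_mul s).smul_const v)

theorem det_fderiv_shift (s : ℝ) (x : Rn n) :
    (ContinuousLinearMap.id ℝ (Rn n) + (s • fderiv ℝ φ x).smulRight v).det =
      1 + s * fderiv ℝ φ x v := by
  have : ((ContinuousLinearMap.id ℝ (Rn n) + (s • fderiv ℝ φ x).smulRight v :
      Rn n →L[ℝ] Rn n) : Rn n →ₗ[ℝ] Rn n) =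
      LinearMap.transvection ((s • fderiv ℝ φ x : Rn n →L[ℝ] ℝ) : Rn n →ₗ[ℝ] ℝ) v := by
    ext y
    simp [LinearMap.transvection.apply]
  rw [ContinuousLinearMap.det, this, LinearMap.transvection.det]
  simp

theorem hasDerivAt_shift (s : ℝ) (x : Rn n) :
    HasDerivAt (fun s => shift φ v s x) (φ x • v) s := by
  simpa [shift] using (((hasDerivAt_id' s).mul_const (φ x)).smul_const v).const_add x

theorem shift_injective {L : ℝ≥0} (hL : LipschitzWith L φ) {s : ℝ} (hs : |s| * (L * ‖v‖) < 1) :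
    Function.Injective (shift φ v s) := by
  intro x y hxy
  have h1 : x - y = (s * (φ y - φ x)) • v := by
    simp only [shift] at hxy
    rw [mul_sub, sub_smul, sub_eq_sub_iff_add_eq_add, hxy, add_comm]
  have h2 : ‖x - y‖ ≤ |s| * (L * ‖v‖) * ‖x - y‖ := by
    calc ‖x - y‖ = |s| * |φ y - φ x| * ‖v‖ := by
          rw [h1, norm_smul, Real.norm_eq_abs, abs_mul]
      _ ≤ |s| * (L * ‖x - y‖) * ‖v‖ := by
          gcongr
          have := hL.dist_le_mul y x
          rwa [Real.dist_eq, dist_eq_norm, norm_sub_rev y x] at this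
      _ = |s| * (L * ‖v‖) * ‖x - y‖ := by ring
  by_contra hne
  have hpos : 0 < ‖x - y‖ := norm_pos_iff.2 (sub_ne_zero.2 hne)
  nlinarith

theorem abs_mul_fderiv_le {L : ℝ≥0} (hL : LipschitzWith L φ) (s : ℝ) (x : Rn n) :
    |s * fderiv ℝ φ x v| ≤ |s| * (L * ‖v‖) := by
  rw [abs_mul]
  gcongr
  exact ((fderiv ℝ φ x).le_opNorm v).trans
    (mul_le_mul_of_nonneg_right (norm_fderiv_le_of_lipschitz ℝ hL) (norm_nonneg v))

theorem eventually_mapsTo_shift {Ω : Set (Rn n)} (hΩ : IsOpen Ω) (hc : HasCompactSupport φ)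
    (hφ : Continuous φ) (hsub : tsupport φ ⊆ Ω) :
    ∀ᶠ s in 𝓝 (0 : ℝ), MapsTo (shift φ v s) Ω Ω := by
  obtain ⟨ε, hε, hth⟩ := hc.isCompact.exists_thickening_subset_open hΩ hsub
  obtain ⟨M, hM⟩ := hc.exists_bound_of_continuous hφ
  have hlim : Tendsto (fun s : ℝ => |s| * (M * ‖v‖)) (𝓝 0) (𝓝 0) := by
    have : Continuous fun s : ℝ => |s| * (M * ‖v‖) := by fun_prop
    simpa using this.tendsto 0
  filter_upwards [hlim.eventually_lt_const hε] with s hs x hx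
  by_cases hxK : x ∈ tsupport φ
  · refine hth (Metric.mem_thickening_iff.2 ⟨x, hxK, ?_⟩)
    rw [dist_eq_norm, shift, add_sub_cancel_left, norm_smul, Real.norm_eq_abs, abs_mul]
    calc |s| * |φ x| * ‖v‖ ≤ |s| * M * ‖v‖ := by
          gcongr
          exact hM x
      _ < ε := by rwa [mul_assoc]
  · rwa [shift, image_eq_zero_of_notMem_tsupport hxK, mul_zero, zero_smul, add_zero]

end Shift

section TransportCost

theorem transportCost_map {ρ : Measure (Rn n)} [IsProbabilityMeasure ρ] {S T : Rn n → Rn n}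
    (hS : Measurable S) (hT : Measurable T) :
    transportCost (ρ.map fun x => (S x, T x)) = ∫⁻ x, ENNReal.ofReal (‖S x - T x‖ ^ 2) ∂ρ := by
  rw [transportCost, lintegral_map (by fun_prop) (hS.prodMk hT)]
  refine lintegral_congr fun x => ?_
  rw [ENNReal.ofReal_pow (norm_nonneg _), ofReal_norm, enorm_eq_nnnorm]

theorem integral_norm_sub_sq_eq {ρ : Measure (Rn n)} [IsProbabilityMeasure ρ] {S T : Rn n → Rn n}
    (hS : Measurable S) (hT : Measurable T) :
    ∫ x, ‖S x - T x‖ ^ 2 ∂ρ = (transportCost (ρ.map fun x => (S x, T x))).toReal := by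
  rw [transportCost_map hS hT, integral_eq_lintegral_of_nonneg_ae
    (Eventually.of_forall fun x => by positivity)
    (by fun_prop : Measurable fun x => ‖S x - T x‖ ^ 2).aestronglyMeasurable]

theorem W2_sq_le_integral {ρ : Measure (Rn n)} [IsProbabilityMeasure ρ] {S T : Rn n → Rn n}
    (hS : Measurable S) (hT : Measurable T) (hFint : Integrable (fun x => ‖S x - T x‖ ^ 2) ρ) :
    W2 (ρ.map S) (ρ.map T) ^ 2 ≤ ∫ x, ‖S x - T x‖ ^ 2 ∂ρ := by
  rw [W2, Real.sq_sqrt ENNReal.toReal_nonneg, integral_norm_sub_sq_eq hS hT]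
  refine ENNReal.toReal_mono ?_ (iInf₂_le _ ⟨?_, ?_, ?_⟩)
  · rw [transportCost_map hS hT]
    exact hFint.lintegral_lt_top.ne
  · exact Measure.isProbabilityMeasure_map (hS.prodMk hT).aemeasurable
  · rw [Measure.map_map measurable_fst (hS.prodMk hT)]
    rfl
  · rw [Measure.map_map measurable_snd (hS.prodMk hT)]
    rfl

theorem IsOptimalMap.W2_sq_eq {ρ μ : Measure (Rn n)} [IsProbabilityMeasure ρ] {T : Rn n → Rn n}
    (hT : IsOptimalMap ρ μ T) : W2 ρ μ ^ 2 = ∫ x, ‖x - T x‖ ^ 2 ∂ρ := by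
  have := integral_norm_sub_sq_eq (ρ := ρ) measurable_id hT.1
  simp only [id] at this
  rw [this, W2, Real.sq_sqrt ENNReal.toReal_nonneg, hT.2.2]

theorem IsOptimalMap.map_eq {ρ μ : Measure (Rn n)} {T : Rn n → Rn n}
    (hT : IsOptimalMap ρ μ T) : ρ.map T = μ := by
  rw [← hT.2.1.2.2, Measure.map_map measurable_snd (measurable_id'.prodMk hT.1)]
  rfl

end TransportCost

section Energy

variable {Ω : Set (Rn n)}

theorem POn.ae_mem {ν : Measure (Rn n)} (hν : ν ∈ POn Ω) : ∀ᵐ x ∂ν, x ∈ Ω := by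
  rw [ae_iff]
  exact hν.2

theorem POn.integrable_of_continuous (hΩ : Bornology.IsBounded Ω) {ν : Measure (Rn n)}
    (hν : ν ∈ POn Ω) {f : Rn n → ℝ} (hf : Continuous f) : Integrable f ν := by
  have := hν.1
  have h := hf.continuousOn.integrableOn_compact (μ := ν) hΩ.isCompact_closure
  rwa [IntegrableOn, Measure.restrict_eq_self_of_ae_mem
    ((POn.ae_mem hν).mono fun x hx => subset_closure hx)] at h

theorem POn.map {ν : Measure (Rn n)} (hν : ν ∈ POn Ω) {T : Rn n → Rn n} (hT : Measurable T)
    (hΩ : MeasurableSet Ω) (hmaps : MapsTo T Ω Ω) : ν.map T ∈ POn Ω := by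
  have := hν.1
  refine ⟨Measure.isProbabilityMeasure_map hT.aemeasurable, ?_⟩
  rw [Measure.map_apply hT hΩ.compl]
  exact measure_mono_null (fun x hx hxΩ => hx (hmaps hxΩ)) hν.2

theorem JKOEnergyOn_eq {h : ℝ} {F : ℝ → ℝ} {W : Rn n → ℝ} {μ ρ : Measure (Rn n)}
    (hac : ρ ≪ volume) (hF : IntegrableOn (fun x => F (dens ρ x)) Ω) (hW : Integrable W ρ) :
    JKOEnergyOn Ω h F W μ ρ =
      ((1 / (2 * h) * W2 ρ μ ^ 2 + ∫ x in Ω, F (dens ρ x)) + ∫ x, W x ∂ρ : ℝ) := by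
  rw [JKOEnergyOn, FfuncEOn, VfuncE, if_pos ⟨hac, hF⟩, if_pos hW, EReal.coe_add, EReal.coe_add]

theorem JKOEnergyOn_eq_top {h : ℝ} {F : ℝ → ℝ} {W : Rn n → ℝ} {μ ρ : Measure (Rn n)}
    (hF : ¬(ρ ≪ volume ∧ IntegrableOn (fun x => F (dens ρ x)) Ω)) :
    JKOEnergyOn Ω h F W μ ρ = ⊤ := by
  rw [JKOEnergyOn, FfuncEOn, if_neg hF, EReal.coe_add_top, EReal.top_add_of_ne_bot]
  rw [VfuncE]
  split_ifs
  · exact EReal.coe_ne_bot _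
  · exact top_ne_bot

theorem exists_JKOEnergyOn_lt_top (hΩ : IsOpen Ω) (hb : Bornology.IsBounded Ω) (hne : Ω.Nonempty)
    (h : ℝ) (F : ℝ → ℝ) {W : Rn n → ℝ} (hW : Continuous W) (μ : Measure (Rn n)) :
    ∃ ρ ∈ POn Ω, JKOEnergyOn Ω h F W μ ρ < ⊤ := by
  have hpos : (volume Ω) ≠ 0 := (hΩ.measure_pos volume hne).ne'
  have hfin : (volume Ω) ≠ ⊤ := hb.measure_lt_top.ne
  have hρ : ProbabilityTheory.cond volume Ω ∈ POn Ω := by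
    refine ⟨ProbabilityTheory.cond_isProbabilityMeasure_of_finite hpos hfin, ?_⟩
    simp [ProbabilityTheory.cond, Measure.restrict_apply hΩ.measurableSet.compl]
  have hd : ProbabilityTheory.cond volume Ω =
      volume.withDensity (Ω.indicator fun _ => (volume Ω)⁻¹) := by
    rw [withDensity_indicator hΩ.measurableSet, withDensity_const, ProbabilityTheory.cond]
  have hrn : (ProbabilityTheory.cond volume Ω).rnDeriv volume =ᵐ[volume]
      Ω.indicator fun _ => (volume Ω)⁻¹ := by
    rw [hd]
    exact Measure.rnDeriv_withDensity _ (measurable_const.indicator hΩ.measurableSet)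
  refine ⟨_, hρ, ?_⟩
  rw [JKOEnergyOn_eq ?_ ?_ (POn.integrable_of_continuous hb hρ hW)]
  · exact EReal.coe_lt_top _
  · rw [hd]
    exact withDensity_absolutelyContinuous _ _
  · have hc : IntegrableOn (fun _ : Rn n => F ((volume Ω)⁻¹).toReal) Ω :=
      integrableOn_const hfin
    refine hc.congr ((ae_restrict_iff' hΩ.measurableSet).2 ?_)
    filter_upwards [hrn] with x hx hxΩ
    rw [dens, hx, indicator_of_mem hxΩ]

end Energy

section ParametricIntegral

theorem integrable_and_hasDerivAt_integral {α : Type*} [MeasurableSpace α] {μ : Measure α}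
    {f f' : ℝ → α → ℝ} {bound : α → ℝ} {δ : ℝ} (hδ : 0 < δ)
    (hf : ∀ s ∈ Metric.ball (0 : ℝ) δ, AEStronglyMeasurable (f s) μ) (hf0 : Integrable (f 0) μ)
    (hf' : AEStronglyMeasurable (f' 0) μ) (hbound : Integrable bound μ)
    (hle : ∀ᵐ a ∂μ, ∀ s ∈ Metric.ball (0 : ℝ) δ, ‖f' s a‖ ≤ bound a)
    (hd : ∀ᵐ a ∂μ, ∀ s ∈ Metric.ball (0 : ℝ) δ, HasDerivAt (fun s => f s a) (f' s a) s) :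
    (∀ s ∈ Metric.ball (0 : ℝ) δ, Integrable (f s) μ) ∧
      HasDerivAt (fun s => ∫ a, f s a ∂μ) (∫ a, f' 0 a ∂μ) 0 := by
  refine ⟨fun s hs => ?_, (hasDerivAt_integral_of_dominated_loc_of_deriv_le
    (Metric.ball_mem_nhds 0 hδ)
    (eventually_of_mem (Metric.ball_mem_nhds 0 hδ) hf) hf0 hf' hle hbound hd).2⟩
  have hdiff : Integrable (fun a => f s a - f 0 a) μ := by
    refine (hbound.mul_const ‖s - 0‖).mono' ((hf s hs).sub hf0.aestronglyMeasurable) ?_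
    filter_upwards [hle, hd] with a ha hda
    exact Convex.norm_image_sub_le_of_norm_hasDerivWithin_le
      (fun t ht => (hda t ht).hasDerivWithinAt) ha (convex_ball 0 δ)
      (Metric.mem_ball_self hδ) hs
  exact (hdiff.add hf0).congr (Eventually.of_forall fun a => sub_add_cancel _ _)

end ParametricIntegral

section FirstVariation

variable {Ω : Set (Rn n)} {ρ : Measure (Rn n)} {φ : Rn n → ℝ} {v : Rn n}

theorem continuous_shift (hφ : Continuous φ) (s : ℝ) : Continuous (shift φ v s) := by
  unfold shift
  fun_prop

theorem inner_gradient_eq (W : Rn n → ℝ) (x w : Rn n) :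
    ⟪gradient W x, w⟫ = fderiv ℝ W x w := by
  rw [← toDual_gradient, InnerProductSpace.toDual_apply_apply]

theorem continuous_gradient {W : Rn n → ℝ} (hW : ContDiff ℝ 1 W) : Continuous (gradient W) :=
  (InnerProductSpace.toDual ℝ (Rn n)).symm.continuous.comp (hW.continuous_fderiv one_ne_zero)

theorem hasDerivAt_integral_cost [IsProbabilityMeasure ρ] {T : Rn n → Rn n} (hT : Measurable T)
    {R M : ℝ} (hR : ∀ᵐ x ∂ρ, ‖x - T x‖ ≤ R) (hφ : Continuous φ) (hM : ∀ x, ‖φ x‖ ≤ M) :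
    (∀ s ∈ Metric.ball (0 : ℝ) 1, Integrable (fun x => ‖shift φ v s x - T x‖ ^ 2) ρ) ∧
      HasDerivAt (fun s => ∫ x, ‖shift φ v s x - T x‖ ^ 2 ∂ρ)
        (∫ x, 2 * (φ x * ⟪x - T x, v⟫) ∂ρ) 0 := by
  have hM0 : 0 ≤ M := (norm_nonneg _).trans (hM 0)
  have hmeas : ∀ s, Measurable fun x => shift φ v s x - T x := fun s =>
    (continuous_shift hφ s).measurable.sub hT
  have key := integrable_and_hasDerivAt_integral (μ := ρ) (δ := 1)
    (f := fun s x => ‖shift φ v s x - T x‖ ^ 2)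
    (f' := fun s x => 2 * ⟪shift φ v s x - T x, φ x • v⟫)
    (bound := fun _ => 2 * ((R + M * ‖v‖) * (M * ‖v‖))) one_pos
    (fun s _ => ((hmeas s).norm.pow_const 2).aestronglyMeasurable)
    (by
      refine Integrable.of_bound ((hmeas 0).norm.pow_const 2).aestronglyMeasurable (R ^ 2) ?_
      filter_upwards [hR] with x hx
      rw [shift_zero, norm_pow, norm_norm]
      gcongr)
    (((hmeas 0).inner (hφ.smul continuous_const).measurable).const_mul 2).aestronglyMeasurable
    (integrable_const _)
    (by
      filter_upwards [hR] with x hx s hs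
      have hs' : |s| ≤ 1 := by simpa using (mem_ball_zero_iff.1 hs).le
      have h1 : ‖φ x • v‖ ≤ M * ‖v‖ := by
        rw [norm_smul]
        gcongr
        exact hM x
      have h2 : ‖shift φ v s x - T x‖ ≤ R + M * ‖v‖ := by
        have : shift φ v s x - T x = (x - T x) + s • φ x • v := by
          rw [shift, smul_smul]
          abel
        rw [this]
        refine (norm_add_le _ _).trans (add_le_add hx ?_)
        rw [norm_smul, Real.norm_eq_abs]
        exact (mul_le_of_le_one_left (norm_nonneg _) hs').trans h1
      rw [norm_mul, Real.norm_ofNat]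
      have h3 := norm_inner_le_norm (𝕜 := ℝ) (shift φ v s x - T x) (φ x • v)
      have h4 : 0 ≤ R + M * ‖v‖ := (norm_nonneg _).trans h2
      gcongr
      exact h3.trans (by gcongr))
    (Eventually.of_forall fun x s _ => ((hasDerivAt_shift s x).sub_const (T x)).norm_sq)
  refine ⟨key.1, key.2.congr_deriv (integral_congr_ae (Eventually.of_forall fun x => ?_))⟩
  simp only [shift_zero, inner_smul_right]

theorem hasDerivAt_integral_potential [IsProbabilityMeasure ρ] {W : Rn n → ℝ}
    (hW : ContDiff ℝ 1 W) {C M : ℝ} (hC : ∀ x, ‖gradient W x‖ ≤ C) (hFint : Integrable W ρ)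
    (hφ : Continuous φ) (hM : ∀ x, ‖φ x‖ ≤ M) :
    HasDerivAt (fun s => ∫ x, W (shift φ v s x) ∂ρ) (∫ x, φ x * ⟪gradient W x, v⟫ ∂ρ) 0 := by
  have hC0 : 0 ≤ C := (norm_nonneg _).trans (hC 0)
  have hM0 : 0 ≤ M := (norm_nonneg _).trans (hM 0)
  have key := integrable_and_hasDerivAt_integral (μ := ρ) (δ := 1)
    (f := fun s x => W (shift φ v s x))
    (f' := fun s x => φ x * ⟪gradient W (shift φ v s x), v⟫)
    (bound := fun _ => M * (C * ‖v‖)) one_pos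
    (fun s _ => (hW.continuous.comp (continuous_shift hφ s)).aestronglyMeasurable)
    (by simpa only [shift_zero] using hFint)
    (hφ.mul (((continuous_gradient hW).comp (continuous_shift hφ 0)).inner
      continuous_const)).aestronglyMeasurable
    (integrable_const _)
    (Eventually.of_forall fun x s _ => by
      rw [norm_mul]
      gcongr
      · exact hM x
      · exact (norm_inner_le_norm _ _).trans (mul_le_mul_of_nonneg_right (hC _) (norm_nonneg v)))
    (Eventually.of_forall fun x s _ => by
      have := ((hW.differentiable one_ne_zero (shift φ v s x)).hasFDerivAt).comp_hasDerivAt s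
        (hasDerivAt_shift s x)
      refine this.congr_deriv ?_
      rw [map_smul, inner_gradient_eq, smul_eq_mul])
  simpa only [shift_zero] using key.2

theorem hasDerivAt_integral_internal {m : ℝ} {F : ℝ → ℝ} (hF : HmClass m F)
    (hFint : IntegrableOn (fun x => F (dens ρ x)) Ω) (hdens : IntegrableOn (dens ρ) Ω)
    (hpow : IntegrableOn (fun x => dens ρ x ^ m) Ω) {L : ℝ≥0}
    (hL : LipschitzWith L φ) (hφ : ContDiff ℝ 1 φ) {δ : ℝ} (hδ : 0 < δ)
    (hδL : δ * (L * ‖v‖) ≤ 1 / 2) :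
    (∀ s ∈ Metric.ball (0 : ℝ) δ, IntegrableOn (fun x => (1 + s * fderiv ℝ φ x v) *
        F (dens ρ x / (1 + s * fderiv ℝ φ x v))) Ω) ∧
      HasDerivAt (fun s => ∫ x in Ω, (1 + s * fderiv ℝ φ x v) *
        F (dens ρ x / (1 + s * fderiv ℝ φ x v)))
        (∫ x in Ω, -pressure F (dens ρ x) * fderiv ℝ φ x v) 0 := by
  obtain ⟨C, hC, hP⟩ := hF.exists_pressure_le
  have hm := hF.one_le
  have hd : Measurable fun x => fderiv ℝ φ x v :=
    ((hφ.continuous_fderiv one_ne_zero).clm_apply continuous_const).measurable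
  have hJ : ∀ s ∈ Metric.ball (0 : ℝ) δ, ∀ x, 1 / 2 ≤ 1 + s * fderiv ℝ φ x v := by
    intro s hs x
    have hs' : |s| ≤ δ := by simpa using (mem_ball_zero_iff.1 hs).le
    have h1 := (abs_le.1 ((abs_mul_fderiv_le (v := v) hL s x).trans
      (mul_le_mul_of_nonneg_right hs' (by positivity)))).1
    linarith
  have hr := measurable_dens ρ
  have key := integrable_and_hasDerivAt_integral (μ := volume.restrict Ω) (δ := δ)
    (f := fun s x => (1 + s * fderiv ℝ φ x v) * F (dens ρ x / (1 + s * fderiv ℝ φ x v)))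
    (f' := fun s x => -pressure F (dens ρ x / (1 + s * fderiv ℝ φ x v)) * fderiv ℝ φ x v)
    (bound := fun x => C * (2 * dens ρ x + 2 ^ m * dens ρ x ^ m) * (L * ‖v‖)) hδ
    (fun s hs => by
      have hJm : Measurable fun x => 1 + s * fderiv ℝ φ x v := (hd.const_mul s).const_add 1
      exact (hJm.mul (hF.measurable_comp (hr.div hJm) fun x =>
        div_nonneg (dens_nonneg ρ x) (by linarith [hJ s hs x]))).aestronglyMeasurable)
    (by simpa [IntegrableOn] using hFint)
    (by
      have : Measurable fun x => -pressure F (dens ρ x) * fderiv ℝ φ x v :=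
        (hF.measurable_pressure_comp hr (dens_nonneg ρ)).neg.mul hd
      simpa using this.aestronglyMeasurable)
    (((hdens.const_mul 2).add (hpow.const_mul (2 ^ m))).const_mul C |>.mul_const _)
    (Eventually.of_forall fun x s hs => by
      have hJx := hJ s hs x
      have hr0 := dens_nonneg ρ x
      have hq0 : 0 ≤ dens ρ x / (1 + s * fderiv ℝ φ x v) := div_nonneg hr0 (by linarith)
      have hq : dens ρ x / (1 + s * fderiv ℝ φ x v) ≤ 2 * dens ρ x := by
        rw [div_le_iff₀ (by linarith)]
        nlinarith
      rw [norm_mul, norm_neg, Real.norm_of_nonneg (hF.pressure_nonneg hq0)]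
      have h1 : ‖fderiv ℝ φ x v‖ ≤ L * ‖v‖ := by
        simpa using abs_mul_fderiv_le (v := v) hL 1 x
      refine mul_le_mul ((hP _ hq0).trans ?_) h1 (norm_nonneg _) (by positivity)
      rw [← Real.mul_rpow zero_le_two hr0]
      gcongr)
    (Eventually.of_forall fun x s hs => by
      have hJx := hJ s hs x
      exact (hF.hasDerivAt_perspective (dens_nonneg ρ x) (by linarith)).comp s
        (((hasDerivAt_mul_const _)).const_add 1))
  refine ⟨key.1, ?_⟩
  simpa using key.2

end FirstVariation

section EulerLagrange

variable {Ω : Set (Rn n)} {m h : ℝ} {F : ℝ → ℝ} {W : Rn n → ℝ} {μ ρ : Measure (Rn n)}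
  {T : Rn n → Rn n}

theorem integrableOn_dens [IsProbabilityMeasure ρ] : IntegrableOn (dens ρ) Ω :=
  Measure.integrable_toReal_rnDeriv.integrableOn

theorem integrableOn_dens_rpow (hb : Bornology.IsBounded Ω) (hF : HmClass m F)
    [IsProbabilityMeasure ρ] (hFint : IntegrableOn (fun x => F (dens ρ x)) Ω) :
    IntegrableOn (fun x => dens ρ x ^ m) Ω := by
  obtain ⟨A, -, hA⟩ := hF.exists_rpow_le
  refine Integrable.mono' (((hFint.abs.add (integrableOn_dens (ρ := ρ))).add
    (integrableOn_const hb.measure_lt_top.ne (C := (1 : ℝ)))).const_mul A)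
    ((measurable_dens ρ).pow_const m).aestronglyMeasurable
    (Eventually.of_forall fun x => ?_)
  rw [Real.norm_of_nonneg (Real.rpow_nonneg (dens_nonneg ρ x) m)]
  exact hA _ (dens_nonneg ρ x)

theorem integrableOn_pressure_dens (hb : Bornology.IsBounded Ω) (hF : HmClass m F)
    [IsProbabilityMeasure ρ] (hFint : IntegrableOn (fun x => F (dens ρ x)) Ω) :
    IntegrableOn (fun x => pressure F (dens ρ x)) Ω := by
  obtain ⟨C, -, hC⟩ := hF.exists_pressure_le
  refine Integrable.mono'
    (((integrableOn_dens (ρ := ρ)).add (integrableOn_dens_rpow hb hF hFint)).const_mul C)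
    (hF.measurable_pressure_comp (measurable_dens ρ) (dens_nonneg ρ)).aestronglyMeasurable
    (Eventually.of_forall fun x => ?_)
  rw [Real.norm_of_nonneg (hF.pressure_nonneg (dens_nonneg ρ x))]
  exact hC _ (dens_nonneg ρ x)

theorem setIntegral_dens_mul [IsProbabilityMeasure ρ] (hΩ : MeasurableSet Ω) (hρ : ρ ∈ POn Ω)
    (hac : ρ ≪ volume) (f : Rn n → ℝ) : ∫ x in Ω, dens ρ x * f x = ∫ x, f x ∂ρ := by
  have := setIntegral_rnDeriv_smul hac hΩ (f := f)
  rwa [Measure.restrict_eq_self_of_ae_mem (POn.ae_mem hρ)] at this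

/-- The weak Euler–Lagrange equation, tested against the vector field `φ v`. -/
theorem weak_euler_lagrange (hΩ : IsOpen Ω) (hb : Bornology.IsBounded Ω) (hF : HmClass m F)
    (hW : ContDiff ℝ 1 W) {C : ℝ} (hC : ∀ x, ‖gradient W x‖ ≤ C) (hh : 0 < h)
    (hρ : ρ ∈ POn Ω)
    (hmin : ∀ ν ∈ POn Ω, JKOEnergyOn Ω h F W μ ρ ≤ JKOEnergyOn Ω h F W μ ν)
    (hac : ρ ≪ volume) (hFint : IntegrableOn (fun x => F (dens ρ x)) Ω)
    (hT : IsOptimalMap ρ μ T) {R : ℝ} (hR : ∀ᵐ x ∂ρ, ‖x - T x‖ ≤ R)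
    {φ : Rn n → ℝ} (hφ : ContDiff ℝ 1 φ) (hφc : HasCompactSupport φ) (hφΩ : tsupport φ ⊆ Ω)
    (v : Rn n) :
    ∫ x in Ω, pressure F (dens ρ x) * fderiv ℝ φ x v =
      ∫ x, (1 / h * (φ x * ⟪x - T x, v⟫) + φ x * ⟪gradient W x, v⟫) ∂ρ := by
  have := hρ.1
  have hΩm := hΩ.measurableSet
  obtain ⟨L, hL⟩ := hφ.lipschitzWith_of_hasCompactSupport hφc one_ne_zero
  obtain ⟨M, hM⟩ := hφc.exists_bound_of_continuous hφ.continuous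
  obtain ⟨δ, hδ, hδL⟩ : ∃ δ > 0, δ * (L * ‖v‖) ≤ 1 / 2 := by
    refine ⟨1 / (2 * (L * ‖v‖ + 1)), by positivity, ?_⟩
    rw [div_mul_eq_mul_div, div_le_div_iff₀ (by positivity) two_pos]
    linarith
  obtain ⟨hAint, hA⟩ := hasDerivAt_integral_cost (v := v) hT.1 hR hφ.continuous hM
  obtain ⟨hBint, hB⟩ := hasDerivAt_integral_internal (v := v) hF hFint integrableOn_dens
    (integrableOn_dens_rpow hb hF hFint) hL hφ hδ hδL
  have hD := hasDerivAt_integral_potential (v := v) hW hC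
    (POn.integrable_of_continuous hb hρ hW.continuous) hφ.continuous hM
  have hΦ := ((hA.const_mul (1 / (2 * h))).add hB).add hD
  have hloc : IsLocalMin (((fun s => 1 / (2 * h) * ∫ x, ‖shift φ v s x - T x‖ ^ 2 ∂ρ) +
      fun s => ∫ x in Ω, (1 + s * fderiv ℝ φ x v) *
        F (dens ρ x / (1 + s * fderiv ℝ φ x v))) + fun s => ∫ x, W (shift φ v s x) ∂ρ) 0 := by
    filter_upwards [Metric.ball_mem_nhds (0 : ℝ) hδ, Metric.ball_mem_nhds (0 : ℝ) one_pos,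
      eventually_mapsTo_shift (v := v) hΩ hφc hφ.continuous hφΩ] with s hsδ hs1 hmaps
    have hs : |s| * (L * ‖v‖) ≤ 1 / 2 :=
      (mul_le_mul_of_nonneg_right (by simpa using (mem_ball_zero_iff.1 hsδ).le)
        (by positivity)).trans hδL
    have hinj := shift_injective hL (by linarith : |s| * (L * ‖v‖) < 1)
    have hSm : Measurable (shift φ v s) := (continuous_shift hφ.continuous s).measurable
    have hJpos : ∀ x, 0 < 1 + s * fderiv ℝ φ x v := fun x => by
      linarith [(abs_le.1 ((abs_mul_fderiv_le (v := v) hL s x).trans hs)).1]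
    have hJm : Measurable fun x => 1 + s * fderiv ℝ φ x v :=
      ((((hφ.continuous_fderiv one_ne_zero).clm_apply
        continuous_const).measurable.const_mul s).const_add 1)
    have hT' := hasFDerivAt_shift (v := v) (hφ.differentiable one_ne_zero) s
    have hν : ρ.map (shift φ v s) ∈ POn Ω := POn.map hρ hSm hΩm hmaps
    have hνac : ρ.map (shift φ v s) ≪ volume := by
      rw [map_eq_withDensity_mapDens hac hρ.2 hΩm hT' hinj (det_fderiv_shift s) hJpos]
      exact withDensity_absolutelyContinuous _ _
    have hle := hmin _ hν
    rw [JKOEnergyOn_eq hac hFint (POn.integrable_of_continuous hb hρ hW.continuous),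
      JKOEnergyOn_eq hνac
        (integrableOn_comp_dens_map hac hρ.2 hΩm hT' hinj (det_fderiv_shift s) hJpos hJm
          hF.map_zero (hBint s hsδ))
        (POn.integrable_of_continuous hb hν hW.continuous), EReal.coe_le_coe_iff,
      setIntegral_comp_dens_map hac hρ.2 hΩm hT' hinj (det_fderiv_shift s) hJpos hJm hmaps
        hF.map_zero, hT.W2_sq_eq,
      integral_map hSm.aemeasurable hW.continuous.aestronglyMeasurable] at hle
    have hW2 := W2_sq_le_integral hSm hT.1 (hAint s hs1)
    rw [hT.map_eq] at hW2
    simp only [Pi.add_apply, shift_zero, zero_mul, add_zero, one_mul, div_one]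
    have := mul_le_mul_of_nonneg_left hW2 (by positivity : 0 ≤ 1 / (2 * h))
    linarith
  have hzero := hloc.hasDerivAt_eq_zero hΦ
  have hTm := hT.1
  have hi1 : Integrable (fun x => 1 / h * (φ x * ⟪x - T x, v⟫)) ρ := by
    refine (Integrable.of_bound (C := M * (R * ‖v‖)) ?_ ?_).const_mul _
    · exact (hφ.continuous.measurable.mul
        ((measurable_id.sub hTm).inner measurable_const)).aestronglyMeasurable
    · filter_upwards [hR] with x hx
      rw [norm_mul]
      exact mul_le_mul (hM x) ((norm_inner_le_norm _ _).trans (by gcongr)) (norm_nonneg _)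
        ((norm_nonneg _).trans (hM x))
  have hi2 : Integrable (fun x => φ x * ⟪gradient W x, v⟫) ρ :=
    POn.integrable_of_continuous hb hρ
      (hφ.continuous.mul ((continuous_gradient hW).inner continuous_const))
  rw [integral_add hi1 hi2]
  simp only [neg_mul, integral_neg, integral_const_mul] at hzero ⊢
  have : 1 / (2 * h) * (2 * ∫ x, φ x * ⟪x - T x, v⟫ ∂ρ) = 1 / h * ∫ x, φ x * ⟪x - T x, v⟫ ∂ρ := by
    field_simp
  linarith

end EulerLagrange

/-- Proposition 6.2, first part: the almost-everywhere
Euler–Lagrange identity on the bounded domain. For every step of the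
semi-implicit JKO scheme on `Ω`, the pressure `P(ρ_h^{k+1})` belongs to
`W^{1,1}(Ω)` and
`(y − T_k(y))ρ_h^{k+1} + h∇(V[ρ_h^k])ρ_h^{k+1} + h∇(P(ρ_h^{k+1})) = 0` a.e. on
`Ω`, where `T_k` is the optimal transport map from `ρ_h^{k+1}` to `ρ_h^k`. -/
theorem ae_euler_lagrange_bounded (n : ℕ) (Ω : Set (Rn n))
    (hΩopen : IsOpen Ω) (hΩbdd : Bornology.IsBounded Ω) (hΩne : Ω.Nonempty)
    (m : ℝ) (hm : 1 ≤ m) (F : ℝ → ℝ) (hF : HmClass m F)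
    (V : Measure (Rn n) → Rn n → ℝ) (hV : VHypOn Ω V)
    (ρ₀ : Measure (Rn n)) (hρ₀ : ρ₀ ∈ PacOn Ω)
    (hinit : FfuncEOn Ω F ρ₀ + VfuncE (V ρ₀) ρ₀ < ⊤)
    (h : ℝ) (hh : 0 < h)
    (ρh : ℕ → Measure (Rn n)) (hJKO : JKOSeqOn Ω h F V ρ₀ ρh)
    (k : ℕ) (Tk : Rn n → Rn n) (hTk : IsOptimalMap (ρh (k + 1)) (ρh k) Tk) :
    ∃ g : Rn n → Rn n,
      HasWeakGradientOn Ω (fun x => pressure F (dens (ρh (k + 1)) x)) g ∧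
      ∀ᵐ y ∂(volume.restrict Ω),
        dens (ρh (k + 1)) y • (y - Tk y)
          + (h * dens (ρh (k + 1)) y) • gradient (V (ρh k)) y
          + h • g y = 0 := by
  have hPOn : ∀ k, ρh k ∈ POn Ω := by
    rintro (_ | k)
    · rw [hJKO.1]
      exact ⟨hρ₀.1, hρ₀.2.2⟩
    · exact (hJKO.2 k).1
  obtain ⟨hVsmooth, -, ⟨C, -, hC⟩, -⟩ := hV
  set μ := ρh k
  set ρ := ρh (k + 1)
  have hμ : μ ∈ POn Ω := hPOn k
  have hρ : ρ ∈ POn Ω := hPOn (k + 1)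
  have hmin := (hJKO.2 k).2
  have := hρ.1
  have hW : ContDiff ℝ 1 (V μ) := (hVsmooth μ hμ).of_le (by norm_num)
  have hgrad : ∀ x, ‖gradient (V μ) x‖ ≤ C := fun x =>
    (le_add_of_nonneg_right (norm_nonneg _)).trans (hC μ hμ x)
  obtain ⟨hac, hFint⟩ : ρ ≪ volume ∧ IntegrableOn (fun x => F (dens ρ x)) Ω := by
    by_contra hcon
    obtain ⟨ν, hν, hlt⟩ := exists_JKOEnergyOn_lt_top hΩopen hΩbdd hΩne h F hW.continuous μ
    exact absurd ((hmin ν hν).trans_lt hlt) (by rw [JKOEnergyOn_eq_top hcon]; exact lt_irrefl _)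
  have hTΩ : ∀ᵐ x ∂ρ, Tk x ∈ Ω := by
    have := POn.ae_mem hμ
    rw [← hTk.map_eq] at this
    exact ae_of_ae_map hTk.1.aemeasurable this
  obtain ⟨R, hR⟩ := Metric.isBounded_iff.1 hΩbdd
  have hdist : ∀ᵐ x ∂ρ, ‖x - Tk x‖ ≤ R := by
    filter_upwards [POn.ae_mem hρ, hTΩ] with x hx hTx
    rw [← dist_eq_norm]
    exact hR hx hTx
  set b : Rn n → Rn n := fun x => (1 / h) • (x - Tk x) + gradient (V μ) x with hb
  have hbint : Integrable b ρ := by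
    have hdisp : Integrable (fun x => x - Tk x) ρ :=
      Integrable.of_bound (measurable_id.sub hTk.1).aestronglyMeasurable R hdist
    exact (hdisp.smul (1 / h)).add (Integrable.of_bound
      (continuous_gradient hW).aestronglyMeasurable C (Eventually.of_forall hgrad))
  refine ⟨fun x => -(dens ρ x • b x), ⟨integrableOn_pressure_dens hΩbdd hF hFint,
    ((integrable_rnDeriv_smul_iff hac).2 hbint).neg.integrableOn, ?_⟩, ?_⟩
  · intro φ hφ hφc hφΩ j
    rw [weak_euler_lagrange hΩopen hΩbdd hF hW hgrad hh hρ hmin hac hFint hTk hdist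
      (hφ.of_le (by exact_mod_cast le_top)) hφc hφΩ,
      ← setIntegral_dens_mul hΩopen.measurableSet hρ hac, ← integral_neg]
    refine integral_congr_ae (Eventually.of_forall fun x => ?_)
    simp only [hb, inner_neg_left, inner_smul_left, inner_add_left, conj_trivial]
    ring
  · refine Eventually.of_forall fun y => ?_
    simp only [hb]
    rw [smul_neg, smul_add, smul_add, smul_smul, smul_smul, smul_smul,
      show h * dens ρ y * (1 / h) = dens ρ y by field_simp]
    abel

end Paper
end
end

section
/- Uniform decay at infinity for sublevels of the Sobolev–moment functional: Let m > 1 and c > 0. There is a constant C (depending only on c, m, n) such that for every nonnegative η ∈ H¹(ℝⁿ) with ∫_{ℝⁿ} η² dx ≤ c, ∫_{ℝⁿ} |∇η|² dx ≤ c, and ∫_{ℝⁿ} |x|² η^{2/m} dx ≤ c, one has, for every R > 0, ∫_{|x|>R} η² dx ≤ C R^{−1/n}. -/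
open MeasureTheory Filter Topology Set
open scoped ENNReal NNReal RealInnerProductSpace Classical

noncomputable section

namespace Paper

variable {n l : ℕ}

/-- A weak gradient represents the weak derivative in every direction. -/
theorem HasWeakGradient.integral_mul_fderiv {f : Rn n → ℝ} {g : Rn n → Rn n}
    (hfg : HasWeakGradient f g) {φ : Rn n → ℝ} (hφ : ContDiff ℝ (⊤ : ℕ∞) φ)
    (hφc : HasCompactSupport φ) (v : Rn n) :
    ∫ x, f x * fderiv ℝ φ x v = -∫ x, ⟪g x, v⟫ * φ x := by
  obtain ⟨hf, hg, hw⟩ := hfg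
  have hv : v = ∑ j, v j • EuclideanSpace.single j (1 : ℝ) := by
    simpa using ((EuclideanSpace.basisFun (Fin n) ℝ).sum_repr v).symm
  have hcont : ∀ w, Continuous fun x => fderiv ℝ φ x w := fun w =>
    (hφ.continuous_fderiv (by simp)).clm_apply continuous_const
  have hcs : ∀ w, HasCompactSupport fun x => fderiv ℝ φ x w := fun w =>
    hφc.fderiv_apply ℝ w
  have hi₁ : ∀ w, Integrable fun x => f x * fderiv ℝ φ x w := fun w =>
    hf.integrable_smul_right_of_hasCompactSupport (hcont w) (hcs w)
  have hi₂ : ∀ w, Integrable fun x => ⟪g x, w⟫ * φ x := fun w => by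
    have := (hg.integrable_smul_left_of_hasCompactSupport hφ.continuous hφc).inner_const
      (𝕜 := ℝ) w
    refine this.congr (ae_of_all _ fun x => ?_)
    simp [real_inner_smul_left, mul_comm]
  have h₁ : ∀ x, f x * fderiv ℝ φ x v =
      ∑ j, v j * (f x * fderiv ℝ φ x (EuclideanSpace.single j 1)) := fun x => by
    conv_lhs => rw [hv]
    simp only [map_sum, map_smul, smul_eq_mul, Finset.mul_sum]
    exact Finset.sum_congr rfl fun j _ => by ring
  have h₂ : ∀ x, ⟪g x, v⟫ * φ x =
      ∑ j, v j * (⟪g x, EuclideanSpace.single j (1 : ℝ)⟫ * φ x) := fun x => by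
    conv_lhs => rw [hv]
    simp only [inner_sum, real_inner_smul_right, Finset.sum_mul]
    exact Finset.sum_congr rfl fun j _ => by ring
  simp_rw [h₁, h₂]
  rw [integral_finsetSum _ fun j _ => (hi₁ _).const_mul _,
    integral_finsetSum _ fun j _ => (hi₂ _).const_mul _, ← Finset.sum_neg_distrib]
  refine Finset.sum_congr rfl fun j _ => ?_
  rw [integral_const_mul, integral_const_mul, hw φ hφ hφc j, mul_neg]

/-- The derivative of a mollification is the mollification of the weak gradient. -/
theorem HasWeakGradient.fderiv_convolution {f : Rn n → ℝ} {g : Rn n → Rn n}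
    (hfg : HasWeakGradient f g) {ψ : Rn n → ℝ} (hψ : ContDiff ℝ (⊤ : ℕ∞) ψ)
    (hψc : HasCompactSupport ψ) (y v : Rn n) :
    fderiv ℝ (convolution ψ f (ContinuousLinearMap.lsmul ℝ ℝ) volume) y v =
      ∫ z, ⟪g z, v⟫ * ψ (y - z) := by
  have hψ1 : ContDiff ℝ 1 ψ := hψ.of_le (by exact_mod_cast le_top)
  rw [(hψc.hasFDerivAt_convolution_left (ContinuousLinearMap.lsmul ℝ ℝ) hψ1 hfg.1 y).fderiv,
    convolution_def, ContinuousLinearMap.integral_apply]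
  · have hφ : ContDiff ℝ (⊤ : ℕ∞) fun z => ψ (y - z) := hψ.comp (contDiff_const.sub contDiff_id)
    have hφc : HasCompactSupport fun z => ψ (y - z) :=
      hψc.comp_homeomorph (Homeomorph.subLeft y)
    have h := hfg.integral_mul_fderiv hφ hφc v
    rw [← integral_sub_left_eq_self _ volume y, ← neg_eq_iff_eq_neg.2 h, ← integral_neg]
    refine integral_congr_ae (ae_of_all _ fun z => ?_)
    have hd : HasFDerivAt (fun z => ψ (y - z)) (-(fderiv ℝ ψ (y - z))) z := by
      have h₁ := (hψ1.differentiable one_ne_zero (y - z)).hasFDerivAt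
      have h₂ := h₁.comp z ((hasFDerivAt_id z).const_sub y)
      simpa [Function.comp_def] using h₂
    simp [hd.fderiv, ContinuousLinearMap.precompL_apply, mul_comm]
  · exact (hψc.fderiv ℝ).convolutionExists_left _ (hψ.continuous_fderiv (by simp)) hfg.1 y

/-- Jensen's inequality for the square and a probability measure. -/
theorem sq_lintegral_le {α : Type*} [MeasurableSpace α] (μ : Measure α) [IsProbabilityMeasure μ]
    {f : α → ℝ≥0∞} (hf : AEMeasurable f μ) : (∫⁻ x, f x ∂μ) ^ 2 ≤ ∫⁻ x, f x ^ 2 ∂μ := by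
  have h := ENNReal.lintegral_mul_le_Lp_mul_Lq μ (p := 2) (q := 2)
    ⟨by norm_num, by norm_num, by norm_num⟩ hf (aemeasurable_const (b := (1 : ℝ≥0∞)))
  simp only [Pi.mul_apply, mul_one, ENNReal.rpow_ofNat, one_pow, lintegral_const, measure_univ,
    ENNReal.one_rpow] at h
  calc (∫⁻ x, f x ∂μ) ^ 2 ≤ ((∫⁻ x, f x ^ 2 ∂μ) ^ (1 / 2 : ℝ)) ^ 2 := by gcongr
    _ = ∫⁻ x, f x ^ 2 ∂μ := by
      rw [← ENNReal.rpow_natCast, ← ENNReal.rpow_mul]; norm_num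

/-- Convolution with a probability density is a contraction in `L²`. -/
theorem lintegral_sq_mollify_le {f : Rn n → ℝ} (hf : AEStronglyMeasurable f volume)
    {ψ : Rn n → ℝ} (hψ : Continuous ψ) (hψ0 : ∀ x, 0 ≤ ψ x)
    (hψ1 : ∫⁻ x, ENNReal.ofReal (ψ x) = 1) :
    ∫⁻ y, ‖∫ z, f z * ψ (y - z)‖ₑ ^ 2 ≤ ∫⁻ z, ‖f z‖ₑ ^ 2 := by
  have hK : Measurable fun x => ENNReal.ofReal (ψ x) := hψ.measurable.ennreal_ofReal
  have hKy : ∀ y, Measurable fun z => ENNReal.ofReal (ψ (y - z)) := fun y =>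
    hK.comp (measurable_const.sub measurable_id)
  have hpt : ∀ y, ‖∫ z, f z * ψ (y - z)‖ₑ ^ 2 ≤
      ∫⁻ z, ‖f z‖ₑ ^ 2 * ENNReal.ofReal (ψ (y - z)) := fun y => by
    have : IsProbabilityMeasure (volume.withDensity fun z => ENNReal.ofReal (ψ (y - z))) := by
      refine ⟨?_⟩
      rw [withDensity_apply _ MeasurableSet.univ, Measure.restrict_univ,
        lintegral_sub_left_eq_self (fun z => ENNReal.ofReal (ψ z)) y, hψ1]
    have hac := withDensity_absolutelyContinuous (volume : Measure (Rn n))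
      fun z => ENNReal.ofReal (ψ (y - z))
    have h := sq_lintegral_le (volume.withDensity fun z => ENNReal.ofReal (ψ (y - z)))
      (hf.enorm.mono_ac hac)
    rw [lintegral_withDensity_eq_lintegral_mul₀ (hKy y).aemeasurable hf.enorm,
      lintegral_withDensity_eq_lintegral_mul₀ (hKy y).aemeasurable (hf.enorm.pow_const 2)] at h
    calc ‖∫ z, f z * ψ (y - z)‖ₑ ^ 2 ≤ (∫⁻ z, ‖f z * ψ (y - z)‖ₑ) ^ 2 := by
          gcongr; exact enorm_integral_le_lintegral_enorm _
      _ = (∫⁻ z, ((fun z => ENNReal.ofReal (ψ (y - z))) * fun z => ‖f z‖ₑ) z) ^ 2 := by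
          congr 2; ext z
          simp [enorm_mul, Real.enorm_of_nonneg (hψ0 _), mul_comm]
      _ ≤ _ := h
      _ = _ := by congr 1; ext z; simp [mul_comm]
  calc ∫⁻ y, ‖∫ z, f z * ψ (y - z)‖ₑ ^ 2
      ≤ ∫⁻ y, ∫⁻ z, ‖f z‖ₑ ^ 2 * ENNReal.ofReal (ψ (y - z)) := lintegral_mono hpt
    _ = ∫⁻ z, ∫⁻ y, ‖f z‖ₑ ^ 2 * ENNReal.ofReal (ψ (y - z)) := by
      have h₁ : AEMeasurable (fun p : Rn n × Rn n => ‖f p.2‖ₑ ^ 2) (volume.prod volume) :=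
        (hf.enorm.pow_const 2).comp_snd
      have h₂ : Measurable fun p : Rn n × Rn n => ENNReal.ofReal (ψ (p.1 - p.2)) :=
        hK.comp (measurable_fst.sub measurable_snd)
      exact lintegral_lintegral_swap (h₁.mul h₂.aemeasurable)
    _ = ∫⁻ z, ‖f z‖ₑ ^ 2 := by
      refine lintegral_congr fun z => ?_
      rw [lintegral_const_mul' _ _ (by finiteness),
        lintegral_sub_right_eq_self (fun y => ENNReal.ofReal (ψ y)) z, hψ1, mul_one]

/-- The `L²` modulus of continuity of a `C¹` function is controlled by its derivative. -/
theorem lintegral_sq_translate_sub_le_of_contDiff {u : Rn n → ℝ} (hu : ContDiff ℝ 1 u)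
    (h : Rn n) :
    ∫⁻ x, ‖u (x + h) - u x‖ₑ ^ 2 ≤ ∫⁻ x, ‖fderiv ℝ u x h‖ₑ ^ 2 := by
  have hw : Continuous fun x => fderiv ℝ u x h :=
    (hu.continuous_fderiv one_ne_zero).clm_apply continuous_const
  have hpt : ∀ x, ‖u (x + h) - u x‖ₑ ^ 2 ≤
      ∫⁻ t in Ioc (0 : ℝ) 1, ‖fderiv ℝ u (x + t • h) h‖ₑ ^ 2 := fun x => by
    have hline : Continuous fun t : ℝ => fderiv ℝ u (x + t • h) h :=
      hw.comp (by fun_prop)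
    have hd : ∀ t : ℝ, HasDerivAt (fun t : ℝ => u (x + t • h)) (fderiv ℝ u (x + t • h) h) t :=
      fun t => by
        have h₁ := (hu.differentiable one_ne_zero (x + t • h)).hasFDerivAt
        have h₂ : HasDerivAt (fun t : ℝ => x + t • h) h t := by
          simpa using ((hasDerivAt_id t).smul_const h).const_add x
        exact h₁.comp_hasDerivAt t h₂
    have hftc := intervalIntegral.integral_eq_sub_of_hasDerivAt (a := 0) (b := 1)
      (fun t _ => hd t) (hline.intervalIntegrable _ _)
    simp only [one_smul, zero_smul, add_zero] at hftc
    rw [← hftc, intervalIntegral.integral_of_le zero_le_one]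
    have : IsProbabilityMeasure ((volume : Measure ℝ).restrict (Ioc 0 1)) := ⟨by simp⟩
    calc _ ≤ (∫⁻ t in Ioc (0 : ℝ) 1, ‖fderiv ℝ u (x + t • h) h‖ₑ) ^ 2 := by
          gcongr; exact enorm_integral_le_lintegral_enorm _
      _ ≤ _ := sq_lintegral_le _ hline.enorm.aemeasurable
  calc ∫⁻ x, ‖u (x + h) - u x‖ₑ ^ 2
      ≤ ∫⁻ x, ∫⁻ t in Ioc (0 : ℝ) 1, ‖fderiv ℝ u (x + t • h) h‖ₑ ^ 2 := lintegral_mono hpt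
    _ = ∫⁻ t in Ioc (0 : ℝ) 1, ∫⁻ x, ‖fderiv ℝ u (x + t • h) h‖ₑ ^ 2 := by
      refine lintegral_lintegral_swap (Measurable.aemeasurable ?_)
      have : Continuous fun p : Rn n × ℝ => fderiv ℝ u (p.1 + p.2 • h) h :=
        hw.comp (by fun_prop)
      exact this.enorm.measurable.pow_const 2
    _ = ∫⁻ x, ‖fderiv ℝ u x h‖ₑ ^ 2 := by
      simp_rw [lintegral_add_right_eq_self (fun x => ‖fderiv ℝ u x h‖ₑ ^ 2)]
      simp

/-- The `L²` modulus of continuity is controlled by the weak gradient. -/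
theorem HasWeakGradient.lintegral_sq_translate_sub_le {f : Rn n → ℝ} {g : Rn n → Rn n}
    (hfg : HasWeakGradient f g) (h : Rn n) :
    ∫⁻ x, ‖f (x + h) - f x‖ₑ ^ 2 ≤ ‖h‖ₑ ^ 2 * ∫⁻ x, ‖g x‖ₑ ^ 2 := by
  let φ : ℕ → ContDiffBump (0 : Rn n) := fun k =>
    ⟨1 / ((k : ℝ) + 1), 2 * (1 / ((k : ℝ) + 1)), by positivity, by
      have : 0 < 1 / ((k : ℝ) + 1) := by positivity
      linarith⟩
  let u : ℕ → Rn n → ℝ := fun k =>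
    convolution ((φ k).normed volume) f (ContinuousLinearMap.lsmul ℝ ℝ) volume
  have hlim : ∀ᵐ x, Tendsto (fun k => u k x) atTop (𝓝 (f x)) := by
    refine ContDiffBump.ae_convolution_tendsto_right_of_locallyIntegrable (K := 2) ?_
      (Eventually.of_forall fun k => le_rfl) hfg.1
    simpa [φ] using (tendsto_one_div_add_atTop_nhds_zero_nat (𝕜 := ℝ)).const_mul 2
  have hlim' : ∀ᵐ x, Tendsto (fun k => u k (x + h)) atTop (𝓝 (f (x + h))) :=
    (measurePreserving_add_right volume h).quasiMeasurePreserving.ae hlim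
  have hu : ∀ k, ContDiff ℝ 1 (u k) := fun k =>
    (φ k).hasCompactSupport_normed.contDiff_convolution_left _
      ((φ k).contDiff_normed (n := 1)) hfg.1
  have hgm := hfg.2.1.aestronglyMeasurable
  have hbound : ∀ k, ∫⁻ x, ‖u k (x + h) - u k x‖ₑ ^ 2 ≤ ‖h‖ₑ ^ 2 * ∫⁻ x, ‖g x‖ₑ ^ 2 := fun k => by
    have hone : ∫⁻ x, ENNReal.ofReal ((φ k).normed volume x) = 1 := by
      rw [← ofReal_integral_eq_lintegral_ofReal (φ k).integrable_normed
        (ae_of_all _ (φ k).nonneg_normed), (φ k).integral_normed, ENNReal.ofReal_one]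
    calc _ ≤ ∫⁻ x, ‖fderiv ℝ (u k) x h‖ₑ ^ 2 := lintegral_sq_translate_sub_le_of_contDiff (hu k) h
      _ = ∫⁻ x, ‖∫ z, ⟪g z, h⟫ * (φ k).normed volume (x - z)‖ₑ ^ 2 := by
        simp_rw [u, hfg.fderiv_convolution (φ k).contDiff_normed (φ k).hasCompactSupport_normed]
      _ ≤ ∫⁻ z, ‖⟪g z, h⟫‖ₑ ^ 2 :=
        lintegral_sq_mollify_le (hgm.inner aestronglyMeasurable_const) (φ k).continuous_normed
          (φ k).nonneg_normed hone
      _ ≤ ∫⁻ z, ‖h‖ₑ ^ 2 * ‖g z‖ₑ ^ 2 := by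
        refine lintegral_mono fun z => ?_
        rw [← mul_pow, mul_comm ‖h‖ₑ]
        gcongr
        simp only [enorm_eq_nnnorm]
        exact_mod_cast nnnorm_inner_le_nnnorm (𝕜 := ℝ) (g z) h
      _ = _ := lintegral_const_mul' _ _ (by finiteness)
  calc ∫⁻ x, ‖f (x + h) - f x‖ₑ ^ 2
      = ∫⁻ x, liminf (fun k => ‖u k (x + h) - u k x‖ₑ ^ 2) atTop := by
        refine lintegral_congr_ae ?_
        filter_upwards [hlim, hlim'] with x h₁ h₂
        exact (ENNReal.Tendsto.pow (n := 2) (h₂.sub h₁).enorm).liminf_eq.symm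
    _ ≤ liminf (fun k => ∫⁻ x, ‖u k (x + h) - u k x‖ₑ ^ 2) atTop := by
        refine lintegral_liminf_le fun k => ?_
        have := (hu k).continuous
        exact (Continuous.enorm (by fun_prop)).measurable.pow_const 2
    _ ≤ liminf (fun _ : ℕ => ‖h‖ₑ ^ 2 * ∫⁻ x, ‖g x‖ₑ ^ 2) atTop :=
        liminf_le_liminf (Eventually.of_forall hbound)
    _ = _ := liminf_const _

/-- A function with weak gradient in `L²` cannot concentrate on sets of small measure. -/
theorem HasWeakGradient.volume_ball_mul_setLIntegral_sq_le {f : Rn n → ℝ} {g : Rn n → Rn n}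
    (hfg : HasWeakGradient f g) (A : Set (Rn n)) (ε : ℝ) :
    volume (Metric.ball (0 : Rn n) ε) * ∫⁻ x in A, ‖f x‖ₑ ^ 2 ≤
      2 * (volume (Metric.ball (0 : Rn n) ε) * (ENNReal.ofReal ε ^ 2 * ∫⁻ x, ‖g x‖ₑ ^ 2)) +
      2 * (volume A * ∫⁻ x, ‖f x‖ₑ ^ 2) := by
  set B := Metric.ball (0 : Rn n) ε
  have hfm := hfg.1.aestronglyMeasurable
  have htr : ∀ h : Rn n, AEStronglyMeasurable (fun x => f (x + h)) volume := fun h =>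
    hfm.comp_quasiMeasurePreserving (measurePreserving_add_right volume h).quasiMeasurePreserving
  have hdiff : ∀ h, AEMeasurable (fun x => 2 * ‖f (x + h) - f x‖ₑ ^ 2) volume := fun h =>
    (((htr h).sub hfm).enorm.pow_const 2).const_mul 2
  have hsq : ∀ h, ∫⁻ x in A, ‖f x‖ₑ ^ 2 ≤
      2 * (∫⁻ x in A, ‖f (x + h) - f x‖ₑ ^ 2) + 2 * ∫⁻ x in A, ‖f (x + h)‖ₑ ^ 2 := fun h => by
    rw [← lintegral_const_mul' _ _ (by finiteness), ← lintegral_const_mul' _ _ (by finiteness),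
      ← lintegral_add_left' (hdiff h).restrict]
    refine lintegral_mono fun x => ?_
    have hr : f x ^ 2 ≤ 2 * (f (x + h) - f x) ^ 2 + 2 * f (x + h) ^ 2 := by
      nlinarith [sq_nonneg (2 * f (x + h) - f x)]
    have := ENNReal.ofReal_le_ofReal hr
    rw [ENNReal.ofReal_add (by positivity) (by positivity), ENNReal.ofReal_mul zero_le_two,
      ENNReal.ofReal_mul zero_le_two] at this
    simpa [← enorm_pow, Real.enorm_of_nonneg (sq_nonneg _)] using this
  have hB : MeasurableSet B := Metric.isOpen_ball.measurableSet
  have hprod : AEMeasurable (fun p : Rn n × Rn n => ‖f (p.2 + p.1)‖ₑ ^ 2)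
      ((volume.restrict B).prod (volume.restrict A)) := by
    refine ((hfm.comp_quasiMeasurePreserving
      (quasiMeasurePreserving_add_swap volume volume)).enorm.pow_const 2).mono_ac ?_
    exact Measure.absolutelyContinuous_of_le Measure.restrict_le_self |>.prod
      (Measure.absolutelyContinuous_of_le Measure.restrict_le_self)
  calc volume B * ∫⁻ x in A, ‖f x‖ₑ ^ 2 = ∫⁻ _ in B, ∫⁻ x in A, ‖f x‖ₑ ^ 2 := by
        rw [setLIntegral_const, mul_comm]
    _ ≤ ∫⁻ h in B, (2 * (ENNReal.ofReal ε ^ 2 * ∫⁻ x, ‖g x‖ₑ ^ 2) +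
          2 * ∫⁻ x in A, ‖f (x + h)‖ₑ ^ 2) := by
        refine setLIntegral_mono' hB fun h hh => (hsq h).trans ?_
        gcongr
        refine (setLIntegral_le_lintegral _ _).trans
          ((hfg.lintegral_sq_translate_sub_le h).trans ?_)
        gcongr
        rw [← ofReal_norm]
        exact ENNReal.ofReal_le_ofReal (mem_ball_zero_iff.1 hh).le
    _ = 2 * (volume B * (ENNReal.ofReal ε ^ 2 * ∫⁻ x, ‖g x‖ₑ ^ 2)) +
          2 * ∫⁻ h in B, ∫⁻ x in A, ‖f (x + h)‖ₑ ^ 2 := by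
        rw [lintegral_add_left measurable_const, setLIntegral_const,
          lintegral_const_mul' _ _ (by finiteness)]
        ring
    _ ≤ _ := by
        gcongr
        rw [lintegral_lintegral_swap hprod]
        calc _ ≤ ∫⁻ _ in A, ∫⁻ x, ‖f x‖ₑ ^ 2 := by
              refine lintegral_mono fun x => (setLIntegral_le_lintegral _ _).trans ?_
              rw [lintegral_add_left_eq_self (fun h => ‖f h‖ₑ ^ 2) x]
          _ = _ := by rw [setLIntegral_const, mul_comm]

/-- uniform decay at infinity, from the proof of Lemma 5.3:
for `m > 1` and `c > 0` there is `C` such that every nonnegative `η ∈ H¹(ℝⁿ)`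
with `∫ η² ≤ c`, `∫ |∇η|² ≤ c` and `∫ |x|² η^{2/m} ≤ c` satisfies
`∫_{|x|>R} η² ≤ C R^{−1/n}` for every `R > 0`. -/
theorem uniform_decay (n : ℕ) (hn : 0 < n) (m : ℝ) (hm : 1 < m)
    (c : ℝ) (hc : 0 < c) :
    ∃ C : ℝ, 0 < C ∧
      ∀ (η : Rn n → ℝ) (g : Rn n → Rn n),
        (∀ x, 0 ≤ η x) →
        HasWeakGradient η g →
        (∫⁻ x, ENNReal.ofReal (η x ^ 2)) ≤ ENNReal.ofReal c →
        (∫⁻ x, ENNReal.ofReal (‖g x‖ ^ 2)) ≤ ENNReal.ofReal c →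
        (∫⁻ x, ENNReal.ofReal (‖x‖ ^ 2 * η x ^ (2 / m))) ≤ ENNReal.ofReal c →
        ∀ R : ℝ, 0 < R →
          (∫⁻ x in {x : Rn n | R < ‖x‖}, ENNReal.ofReal (η x ^ 2)) ≤
            ENNReal.ofReal (C * R ^ (-(1 : ℝ) / n)) := by
  set ω : ℝ := volume.real (Metric.ball (0 : Rn n) 1)
  have hω : 0 < ω := ENNReal.toReal_pos (Metric.measure_ball_pos _ _ one_pos).ne' measure_ball_lt_top.ne
  have hωe : volume (Metric.ball (0 : Rn n) 1) = ENNReal.ofReal ω :=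
    (ENNReal.ofReal_toReal measure_ball_lt_top.ne).symm
  have hn1 : (1 : ℝ) ≤ n := by exact_mod_cast hn
  refine ⟨c + 2 * c + 2 * c ^ 2 / ω, by positivity, fun η g hη hw h2 hg hm2 R hR => ?_⟩
  have hηe : ∀ x, ‖η x‖ₑ ^ 2 = ENNReal.ofReal (η x ^ 2) := fun x => by
    rw [← enorm_pow, Real.enorm_of_nonneg (sq_nonneg _)]
  have hge : ∀ x, ‖g x‖ₑ ^ 2 = ENNReal.ofReal (‖g x‖ ^ 2) := fun x => by
    rw [ENNReal.ofReal_pow (norm_nonneg _), ofReal_norm]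
  rcases le_total R 1 with hR1 | hR1
  · refine (setLIntegral_le_lintegral _ _).trans (h2.trans (ENNReal.ofReal_le_ofReal ?_))
    have h1 : 1 ≤ R ^ (-(1 : ℝ) / n) :=
      Real.one_le_rpow_of_pos_of_le_one_of_nonpos hR hR1
        (div_nonpos_of_nonpos_of_nonneg (by norm_num) (by positivity))
    have : 0 ≤ 2 * c + 2 * c ^ 2 / ω := by positivity
    nlinarith
  set S : Set (Rn n) := {x | R < ‖x‖}
  have hS : MeasurableSet S := measurableSet_lt measurable_const measurable_norm
  have hpow : ∀ x, 0 ≤ η x ^ (2 / m) := fun x => Real.rpow_nonneg (hη x) _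
  have hηm : AEMeasurable η volume := hw.1.aestronglyMeasurable.aemeasurable
  have hmom : ∫⁻ x in S, ENNReal.ofReal (η x ^ (2 / m)) ≤ ENNReal.ofReal (c / R ^ 2) := by
    have : ENNReal.ofReal (R ^ 2) * ∫⁻ x in S, ENNReal.ofReal (η x ^ (2 / m)) ≤
        ENNReal.ofReal c := by
      rw [← lintegral_const_mul' _ _ ENNReal.ofReal_ne_top]
      refine le_trans (setLIntegral_mono' hS fun x hx => ?_)
        ((setLIntegral_le_lintegral _ _).trans hm2)
      rw [← ENNReal.ofReal_mul (by positivity)]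
      refine ENNReal.ofReal_le_ofReal (mul_le_mul_of_nonneg_right ?_ (hpow x))
      exact pow_le_pow_left₀ hR.le (le_of_lt hx) 2
    rw [ENNReal.ofReal_div_of_pos (by positivity)]
    exact ENNReal.le_div_iff_mul_le (Or.inl (by simp [hR.ne'])) (Or.inl (by simp)) |>.2 (by rwa [mul_comm])
  set A : Set (Rn n) := {x ∈ S | 1 < η x}
  have hA : volume A ≤ ENNReal.ofReal (c / R ^ 2) := by
    have hmk := meas_ge_le_lintegral_div (μ := volume.restrict S)
      (f := fun x => ENNReal.ofReal (η x ^ (2 / m)))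
      ((hηm.pow_const _).ennreal_ofReal.restrict) one_ne_zero ENNReal.one_ne_top
    rw [div_one, Measure.restrict_apply' hS] at hmk
    refine le_trans (measure_mono ?_) (hmk.trans hmom)
    intro x hx
    exact ⟨by simpa using Real.one_le_rpow hx.2.le (by positivity : 0 ≤ 2 / m), hx.1⟩
  set ε : ℝ := R ^ (-(1 : ℝ) / (2 * n)) with hεdef
  have hε : 0 < ε := by positivity
  have hε2 : ε ^ 2 = R ^ (-(1 : ℝ) / n) := by
    rw [hεdef, ← Real.rpow_natCast, ← Real.rpow_mul hR.le]
    congr 1; push_cast; field_simp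
  have hεn : R ^ (-(1 : ℝ) / 2) = ε ^ n := by
    rw [hεdef, ← Real.rpow_natCast, ← Real.rpow_mul hR.le]
    congr 1; field_simp
  have hdecay : 1 / (R ^ 2 * ε ^ n) ≤ R ^ (-(1 : ℝ) / n) := by
    rw [← hεn, ← Real.rpow_natCast, ← Real.rpow_add hR, one_div, ← Real.rpow_neg hR.le]
    refine Real.rpow_le_rpow_of_exponent_le hR1 ?_
    have : 1 / (n : ℝ) ≤ 1 := by rw [div_le_one (by positivity)]; exact hn1
    rw [neg_div (n : ℝ) 1]
    push_cast
    linarith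
  have hdecay2 : 1 / R ^ 2 ≤ R ^ (-(1 : ℝ) / n) := by
    refine le_trans ?_ hdecay
    refine one_div_le_one_div_of_le (by positivity) ?_
    have : ε ^ n ≤ 1 := by
      rw [← hεn]; exact Real.rpow_le_one_of_one_le_of_nonpos hR1 (by norm_num)
    nlinarith [sq_nonneg R]
  have hlarge : ∫⁻ x in A, ENNReal.ofReal (η x ^ 2) ≤
      ENNReal.ofReal (2 * (ε ^ 2 * c) + 2 * c ^ 2 / ω * (1 / (R ^ 2 * ε ^ n))) := by
    have hV : volume (Metric.ball (0 : Rn n) ε) = ENNReal.ofReal (ε ^ n * ω) := by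
      rw [Measure.addHaar_ball_of_pos _ _ hε, hωe, finrank_euclideanSpace_fin,
        ENNReal.ofReal_mul (by positivity)]
    have hmain := hw.volume_ball_mul_setLIntegral_sq_le A ε
    simp only [hηe, hge, hV] at hmain
    have hub : ENNReal.ofReal (ε ^ n * ω) * ∫⁻ x in A, ENNReal.ofReal (η x ^ 2) ≤
        ENNReal.ofReal (2 * (ε ^ n * ω * (ε ^ 2 * c)) + 2 * (c / R ^ 2 * c)) := by
      refine hmain.trans ?_
      rw [ENNReal.ofReal_add (by positivity) (by positivity), ENNReal.ofReal_mul zero_le_two,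
        ENNReal.ofReal_mul (p := ε ^ n * ω) (by positivity), ENNReal.ofReal_mul (p := ε ^ 2) (by positivity),
        ENNReal.ofReal_mul (p := 2) zero_le_two, ENNReal.ofReal_mul (p := c / R ^ 2) (by positivity),
        ENNReal.ofReal_pow hε.le 2, ENNReal.ofReal_ofNat]
      gcongr
    have hpos : 0 < ε ^ n * ω := by positivity
    rw [mul_comm, ← ENNReal.le_div_iff_mul_le (by simp [hpos]) (by simp),
      ← ENNReal.ofReal_div_of_pos hpos] at hub
    refine hub.trans (ENNReal.ofReal_le_ofReal (le_of_eq ?_))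
    field_simp
  have hsmall : ∫⁻ x in S \ A, ENNReal.ofReal (η x ^ 2) ≤ ENNReal.ofReal (c / R ^ 2) := by
    have hae : NullMeasurableSet A volume :=
      hS.nullMeasurableSet.inter (nullMeasurableSet_lt aemeasurable_const hηm)
    refine le_trans (le_trans (lintegral_mono_ae ?_)
      (lintegral_mono_set (s := S \ A) (t := S) sdiff_subset)) hmom
    refine (ae_restrict_iff'₀ (hS.nullMeasurableSet.diff hae)).2 (ae_of_all _ fun x hx => ?_)
    have hx1 : η x ≤ 1 := not_lt.1 fun h => hx.2 ⟨hx.1, h⟩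
    refine ENNReal.ofReal_le_ofReal ?_
    rw [← Real.rpow_natCast]
    refine Real.rpow_le_rpow_of_exponent_ge_of_imp (hη x) hx1 ?_ ?_
    · push_cast; rw [div_le_iff₀ (by linarith)]; linarith
    · intro _ h; simp at h
  calc ∫⁻ x in S, ENNReal.ofReal (η x ^ 2)
      ≤ ∫⁻ x in A ∪ S \ A, ENNReal.ofReal (η x ^ 2) :=
        lintegral_mono_set (by rw [union_sdiff_self]; exact subset_union_right)
    _ ≤ _ := lintegral_union_le _ _ _
    _ ≤ _ := add_le_add hlarge hsmall
    _ = ENNReal.ofReal (2 * (ε ^ 2 * c) + 2 * c ^ 2 / ω * (1 / (R ^ 2 * ε ^ n)) + c / R ^ 2) :=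
        (ENNReal.ofReal_add (by positivity) (by positivity)).symm
    _ ≤ _ := by
        refine ENNReal.ofReal_le_ofReal ?_
        rw [hε2, div_eq_mul_one_div c (R ^ 2)]
        have h₁ := mul_le_mul_of_nonneg_left hdecay (by positivity : 0 ≤ 2 * c ^ 2 / ω)
        have h₂ := mul_le_mul_of_nonneg_left hdecay2 hc.le
        linarith

end Paper
end
end
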